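/- arXiv:2605.11586 — 6 statements merged into one kernel-verified Lean document; each statement's English description precedes it below -/
import Mathlib

section
/- Strong duality for weakly communicating average-reward CMDPs: Let (S, A, P) be a weakly communicating MDP with finite state space S and finite action space A, let s₁ ∈ S be any initial state, let r, g : S × A → ℝ take values in [0,1], and let b ∈ [0,1]. Suppose the problem is feasible, i.e., there exists q ∈ Q(s₁) with g·q ≥ b. Define the primal value J* = sup { r·q : q ∈ Q(s₁), g·q ≥ b }. Then: (1) there exists λ* ≥ 0 such that D(λ*) = inf_{λ ≥ 0} D(λ); and (2) J* = D(λ*). -/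
open Finset Filter Topology

noncomputable section

/-- `P` is a transition kernel: nonnegative and each row sums to one. -/
def IsKernel {S A : Type*} [Fintype S] (P : S → A → S → ℝ) : Prop :=
  (∀ s a s', 0 ≤ P s a s') ∧ ∀ s a, ∑ s', P s a s' = 1

/-- `π` is a stationary randomized policy. -/
def IsPolicy {S A : Type*} [Fintype A] (π : S → A → ℝ) : Prop :=
  (∀ s a, 0 ≤ π s a) ∧ ∀ s, ∑ a, π s a = 1

/-- The Markov matrix induced by policy `π` on kernel `P`. -/
def markovMatrix {S A : Type*} [Fintype A] (P : S → A → S → ℝ) (π : S → A → ℝ) :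
    Matrix S S ℝ :=
  fun s s' => ∑ a, π s a * P s a s'

/-- `C` is closed under the Markov matrix `M`. -/
def IsClosedClass {S : Type*} (M : Matrix S S ℝ) (C : Set S) : Prop :=
  ∀ s ∈ C, ∀ s' ∉ C, M s s' = 0

/-- `C` is irreducible under the Markov matrix `M`. -/
def IsIrreducibleOn {S : Type*} [Fintype S] [DecidableEq S] (M : Matrix S S ℝ)
    (C : Set S) : Prop :=
  ∀ s ∈ C, ∀ s' ∈ C, ∃ n : ℕ, 0 < (M ^ n) s s'

/-- `s` is a transient state under the Markov matrix `M`. -/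
def IsTransient {S : Type*} [Fintype S] [DecidableEq S] (M : Matrix S S ℝ) (s : S) : Prop :=
  Summable fun n : ℕ => (M ^ (n + 1)) s s

/-- The MDP `(S, A, P)` is weakly communicating. -/
def WeaklyCommunicating {S A : Type*} [Fintype S] [DecidableEq S] [Fintype A]
    (P : S → A → S → ℝ) : Prop :=
  ∃ (π : S → A → ℝ) (C : Set S), IsPolicy π ∧ C.Nonempty ∧
    IsClosedClass (markovMatrix P π) C ∧ IsIrreducibleOn (markovMatrix P π) C ∧
    ∀ s ∉ C, ∀ π' : S → A → ℝ, IsPolicy π' → IsTransient (markovMatrix P π') s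

/-- `q` is the occupation measure of the policy `π` from initial state `s₁`:
the Cesàro averages `(1/T) ∑_{t=1}^T (P_π^{t-1})(s₁,s) ⬝ π s a` converge to `q (s,a)`. -/
def IsOccupation {S A : Type*} [Fintype S] [DecidableEq S] [Fintype A]
    (P : S → A → S → ℝ) (π : S → A → ℝ) (s₁ : S) (q : S × A → ℝ) : Prop :=
  ∀ s a, Tendsto
    (fun T : ℕ => (1 / (T : ℝ)) * ∑ t ∈ Finset.range T, ((markovMatrix P π) ^ t) s₁ s * π s a)
    atTop (𝓝 (q (s, a)))

/-- `Q(s₁)`: the set of occupation measures of stationary policies from `s₁`. -/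
def occSet {S A : Type*} [Fintype S] [DecidableEq S] [Fintype A]
    (P : S → A → S → ℝ) (s₁ : S) : Set (S × A → ℝ) :=
  {q | ∃ π : S → A → ℝ, IsPolicy π ∧ IsOccupation P π s₁ q}

/-- `c·q = ∑_{(s,a)} c(s,a) q(s,a)`. -/
def dotSA {S A : Type*} [Fintype S] [Fintype A] (c q : S × A → ℝ) : ℝ :=
  ∑ p, c p * q p

/-- The dual function `D(λ) = sup { r·q + λ(g·q − b) : q ∈ Q(s₁) }`. -/
def dualFn {S A : Type*} [Fintype S] [DecidableEq S] [Fintype A]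
    (P : S → A → S → ℝ) (s₁ : S) (r g : S × A → ℝ) (b : ℝ) (lam : ℝ) : ℝ :=
  sSup {x | ∃ q ∈ occSet P s₁, x = dotSA r q + lam * (dotSA g q - b)}

/-- The flow polytope `𝓟`. -/
def flowPolytope {S A : Type*} [Fintype S] [Fintype A] (P : S → A → S → ℝ) :
    Set (S × A → ℝ) :=
  {q | (∀ p, 0 ≤ q p) ∧ (∑ p, q p = 1) ∧
    ∀ s, ∑ a, q (s, a) = ∑ p : S × A, P p.1 p.2 s * q p}


/-- The Cesàro average of the first `T` powers of `M`. -/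
def cesaroMean {S : Type*} [Fintype S] [DecidableEq S] (M : Matrix S S ℝ) (T : ℕ) :
    Matrix S S ℝ :=
  (1 / (T : ℝ)) • ∑ t ∈ Finset.range T, M ^ t

/-- The support of a nonnegative stationary vector is closed. -/
lemma isClosedClass_support {S : Type*} [Fintype S] {M : Matrix S S ℝ}
    (hM : ∀ i j, 0 ≤ M i j) {μ : S → ℝ} (h0 : ∀ s, 0 ≤ μ s) (hμ : Matrix.vecMul μ M = μ) :
    IsClosedClass M {s | μ s ≠ 0} := by
  intro x hx y hy
  have hy' : μ y = 0 := by simpa using hy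
  have h : ∑ z, μ z * M z y = 0 := (congrFun hμ y).trans hy'
  have := (Finset.sum_eq_zero_iff_of_nonneg fun z _ => mul_nonneg (h0 z) (hM z y)).1 h x
    (Finset.mem_univ x)
  exact (mul_eq_zero.1 this).resolve_left hx

section Cesaro

variable {S : Type*} [Fintype S] [DecidableEq S] {M : Matrix S S ℝ}

lemma cesaroMean_apply (M : Matrix S S ℝ) (T : ℕ) (i j : S) :
    cesaroMean M T i j = (1 / (T : ℝ)) * ∑ t ∈ Finset.range T, (M ^ t) i j := by
  simp [cesaroMean, Matrix.sum_apply]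

lemma cesaroMean_mem_Icc (hM : M ∈ Matrix.rowStochastic ℝ S) (T : ℕ) (i j : S) :
    cesaroMean M T i j ∈ Set.Icc (0 : ℝ) 1 := by
  rw [cesaroMean_apply]
  have h0 : 0 ≤ ∑ t ∈ Finset.range T, (M ^ t) i j :=
    Finset.sum_nonneg fun t _ => Matrix.nonneg_of_mem_rowStochastic (pow_mem hM t)
  refine ⟨by positivity, ?_⟩
  rcases Nat.eq_zero_or_pos T with rfl | hT
  · simp
  have h1 : ∑ t ∈ Finset.range T, (M ^ t) i j ≤ ∑ _t ∈ Finset.range T, (1 : ℝ) :=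
    Finset.sum_le_sum fun t _ => Matrix.le_one_of_mem_rowStochastic (pow_mem hM t)
  have hT' : (0 : ℝ) < T := by exact_mod_cast hT
  rw [one_div, inv_mul_le_iff₀ hT']
  simpa using h1

lemma cesaroMean_mul_sub (M : Matrix S S ℝ) (T : ℕ) :
    cesaroMean M T * M - cesaroMean M T = (1 / (T : ℝ)) • (M ^ T - 1) := by
  rw [← geom_sum_mul, cesaroMean, ← smul_mul_assoc, mul_sub, mul_one]

lemma mul_cesaroMean_sub (M : Matrix S S ℝ) (T : ℕ) :
    M * cesaroMean M T - cesaroMean M T = (1 / (T : ℝ)) • (M ^ T - 1) := by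
  rw [← mul_geom_sum, cesaroMean, ← mul_smul_comm, sub_mul, one_mul]

lemma tendsto_smul_pow_sub_one (hM : M ∈ Matrix.rowStochastic ℝ S) :
    Tendsto (fun T : ℕ => (1 / (T : ℝ)) • (M ^ T - 1)) atTop (𝓝 0) := by
  refine tendsto_pi_nhds.2 fun i => tendsto_pi_nhds.2 fun j => ?_
  refine squeeze_zero_norm (a := fun T : ℕ => 1 / (T : ℝ)) (fun T => ?_)
    tendsto_one_div_atTop_nhds_zero_nat
  have h0 : 0 ≤ (M ^ T) i j := Matrix.nonneg_of_mem_rowStochastic (pow_mem hM T)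
  have h1 : (M ^ T) i j ≤ 1 := Matrix.le_one_of_mem_rowStochastic (pow_mem hM T)
  have h2 : |(M ^ T) i j - (1 : Matrix S S ℝ) i j| ≤ 1 := by
    rw [Matrix.one_apply]
    split_ifs <;> rw [abs_le] <;> constructor <;> linarith
  have hT : (0 : ℝ) ≤ 1 / T := by positivity
  simpa [abs_mul] using mul_le_mul_of_nonneg_left h2 hT

lemma mul_eq_of_tendsto_cesaroMean (hM : M ∈ Matrix.rowStochastic ℝ S) {l : Filter ℕ} [l.NeBot]
    (hl : l ≤ atTop) {L : Matrix S S ℝ} (hL : Tendsto (cesaroMean M) l (𝓝 L)) :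
    L * M = L ∧ M * L = L := by
  have h0 := (tendsto_smul_pow_sub_one hM).mono_left hl
  constructor
  · have h := (hL.mul_const M).sub hL
    simp only [cesaroMean_mul_sub] at h
    exact sub_eq_zero.1 (tendsto_nhds_unique h h0)
  · have h := (hL.const_mul M).sub hL
    simp only [mul_cesaroMean_sub] at h
    exact sub_eq_zero.1 (tendsto_nhds_unique h h0)

lemma mul_cesaroMean_of_mul_eq {N : Matrix S S ℝ} (h : N * M = N) {T : ℕ} (hT : T ≠ 0) :
    N * cesaroMean M T = N := by
  have hp : ∀ t : ℕ, N * M ^ t = N := fun t => by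
    induction t with
    | zero => simp
    | succ t ih => rw [pow_succ, ← mul_assoc, ih, h]
  have hT' : (T : ℝ) ≠ 0 := by exact_mod_cast hT
  rw [cesaroMean, mul_smul_comm, Finset.mul_sum, Finset.sum_congr rfl fun t _ => hp t]
  rw [Finset.sum_const, Finset.card_range, ← Nat.cast_smul_eq_nsmul ℝ, smul_smul,
    one_div_mul_cancel hT', one_smul]

lemma cesaroMean_mul_of_mul_eq {N : Matrix S S ℝ} (h : M * N = N) {T : ℕ} (hT : T ≠ 0) :
    cesaroMean M T * N = N := by
  have hp : ∀ t : ℕ, M ^ t * N = N := fun t => by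
    induction t with
    | zero => simp
    | succ t ih => rw [pow_succ, mul_assoc, h, ih]
  have hT' : (T : ℝ) ≠ 0 := by exact_mod_cast hT
  rw [cesaroMean, smul_mul_assoc, Finset.sum_mul, Finset.sum_congr rfl fun t _ => hp t]
  rw [Finset.sum_const, Finset.card_range, ← Nat.cast_smul_eq_nsmul ℝ, smul_smul,
    one_div_mul_cancel hT', one_smul]

lemma vecMul_cesaroMean {μ : S → ℝ} (h : Matrix.vecMul μ M = μ) {T : ℕ} (hT : T ≠ 0) :
    Matrix.vecMul μ (cesaroMean M T) = μ := by
  have hN : (Matrix.of fun _ : S => μ) * M = Matrix.of fun _ : S => μ := by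
    ext i j
    exact congrFun h j
  ext j
  exact congrFun (congrFun (mul_cesaroMean_of_mul_eq hN hT) j) j

/-- The Cesàro averages of the powers of a stochastic matrix converge. -/
lemma exists_tendsto_cesaroMean (hM : M ∈ Matrix.rowStochastic ℝ S) :
    ∃ L : Matrix S S ℝ, Tendsto (cesaroMean M) atTop (𝓝 L) := by
  have hK : IsCompact (Set.univ.pi fun _ : S => Set.univ.pi fun _ : S => Set.Icc (0 : ℝ) 1) :=
    isCompact_univ_pi fun _ => isCompact_univ_pi fun _ => isCompact_Icc
  have hmem : ∀ T, cesaroMean M T ∈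
      (Set.univ.pi fun _ : S => Set.univ.pi fun _ : S => Set.Icc (0 : ℝ) 1) :=
    fun T i _ j _ => cesaroMean_mem_Icc hM T i j
  obtain ⟨(L : Matrix S S ℝ), -, hL⟩ := hK.exists_mapClusterPt (f := (atTop : Filter ℕ))
    (u := cesaroMean M) (tendsto_principal.2 (Eventually.of_forall hmem))
  refine ⟨L, hK.tendsto_nhds_of_unique_mapClusterPt (Eventually.of_forall hmem)
    fun (N : Matrix S S ℝ) _ hN => ?_⟩
  obtain ⟨U, hU, hLU⟩ := mapClusterPt_iff_ultrafilter.1 hL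
  obtain ⟨V, hV, hNV⟩ := mapClusterPt_iff_ultrafilter.1 hN
  replace hLU : Tendsto (cesaroMean M) U (𝓝 L) := hLU
  replace hNV : Tendsto (cesaroMean M) V (𝓝 N) := hNV
  have hL' := (mul_eq_of_tendsto_cesaroMean hM hU hLU).2
  have hN' := (mul_eq_of_tendsto_cesaroMean hM hV hNV).1
  have h1 : Tendsto (fun T => N * cesaroMean M T) U (𝓝 N) :=
    tendsto_const_nhds.congr' (((eventually_ne_atTop 0).filter_mono hU).mono fun T hT =>
      (mul_cesaroMean_of_mul_eq hN' hT).symm)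
  have h2 : Tendsto (fun T => cesaroMean M T * L) V (𝓝 L) :=
    tendsto_const_nhds.congr' (((eventually_ne_atTop 0).filter_mono hV).mono fun T hT =>
      (cesaroMean_mul_of_mul_eq hL' hT).symm)
  exact (tendsto_nhds_unique h1 (hLU.const_mul N)).trans
    (tendsto_nhds_unique (hNV.mul_const L) h2)

/-- The Cesàro limit of the powers of `M` (arbitrary if the limit does not exist). -/
def cesaroLimit (M : Matrix S S ℝ) : Matrix S S ℝ :=
  limUnder atTop (cesaroMean M)

lemma tendsto_cesaroLimit (hM : M ∈ Matrix.rowStochastic ℝ S) :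
    Tendsto (cesaroMean M) atTop (𝓝 (cesaroLimit M)) :=
  tendsto_nhds_limUnder (exists_tendsto_cesaroMean hM)

lemma tendsto_cesaroLimit_apply (hM : M ∈ Matrix.rowStochastic ℝ S) (i j : S) :
    Tendsto (fun T => cesaroMean M T i j) atTop (𝓝 (cesaroLimit M i j)) :=
  tendsto_pi_nhds.1 (tendsto_pi_nhds.1 (tendsto_cesaroLimit hM) i) j

lemma cesaroLimit_mul (hM : M ∈ Matrix.rowStochastic ℝ S) :
    cesaroLimit M * M = cesaroLimit M :=
  (mul_eq_of_tendsto_cesaroMean hM le_rfl (tendsto_cesaroLimit hM)).1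

lemma cesaroLimit_vecMul (hM : M ∈ Matrix.rowStochastic ℝ S) (i : S) :
    Matrix.vecMul (cesaroLimit M i) M = cesaroLimit M i := by
  ext j
  exact congrFun (congrFun (cesaroLimit_mul hM) i) j

lemma vecMul_cesaroLimit (hM : M ∈ Matrix.rowStochastic ℝ S) {μ : S → ℝ}
    (h : Matrix.vecMul μ M = μ) : Matrix.vecMul μ (cesaroLimit M) = μ := by
  have h1 : Tendsto (fun T => Matrix.vecMul μ (cesaroMean M T)) atTop
      (𝓝 (Matrix.vecMul μ (cesaroLimit M))) :=
    ((continuous_const.matrix_vecMul continuous_id).tendsto _).comp (tendsto_cesaroLimit hM)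
  refine tendsto_nhds_unique h1 (tendsto_const_nhds.congr' ?_)
  exact (eventually_ne_atTop 0).mono fun T hT => (vecMul_cesaroMean h hT).symm

lemma cesaroLimit_mem (hM : M ∈ Matrix.rowStochastic ℝ S) :
    cesaroLimit M ∈ Matrix.rowStochastic ℝ S := by
  rw [Matrix.mem_rowStochastic_iff_sum]
  refine ⟨fun i j => ge_of_tendsto' (tendsto_cesaroLimit_apply hM i j)
    fun T => (cesaroMean_mem_Icc hM T i j).1, fun i => ?_⟩
  refine tendsto_nhds_unique
    (tendsto_finsetSum _ fun j _ => tendsto_cesaroLimit_apply hM i j)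
    (tendsto_const_nhds.congr' ?_)
  filter_upwards [eventually_ne_atTop 0] with T hT
  have hT' : (T : ℝ) ≠ 0 := by exact_mod_cast hT
  simp only [cesaroMean_apply]
  rw [← Finset.mul_sum, Finset.sum_comm]
  simp_rw [fun t => Matrix.sum_row_of_mem_rowStochastic (pow_mem hM t) i]
  simp [hT']

/-- A transient state carries no mass under the Cesàro limit, whatever the starting state. -/
lemma cesaroLimit_apply_eq_zero_of_isTransient (hM : M ∈ Matrix.rowStochastic ℝ S) {s : S}
    (hs : IsTransient M s) (x : S) : cesaroLimit M x s = 0 := by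
  set L := cesaroLimit M with hLdef
  have hLs := cesaroLimit_mem hM
  have h0 : L s s = 0 := by
    have h1 : Tendsto (fun n : ℕ => (M ^ n) s s) atTop (𝓝 0) :=
      (tendsto_add_atTop_iff_nat 1).1 hs.tendsto_atTop_zero
    refine tendsto_nhds_unique (tendsto_cesaroLimit_apply hM s s) ?_
    simpa [cesaroMean_apply] using h1.cesaro
  have hLL : ∀ y, ∑ z, L y z * L z s = L y s := fun y =>
    congrFun (vecMul_cesaroLimit hM (cesaroLimit_vecMul hM y)) s
  obtain ⟨y, -, hy⟩ := Finset.exists_max_image Finset.univ (fun y => L y s) ⟨s, Finset.mem_univ s⟩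
  have hsum : ∑ z, L y z * (L y s - L z s) = 0 := by
    simp only [mul_sub, Finset.sum_sub_distrib, ← Finset.sum_mul]
    rw [Matrix.sum_row_of_mem_rowStochastic hLs, hLL, one_mul, sub_self]
  have hnn : ∀ z, 0 ≤ L y z := fun z => Matrix.nonneg_of_mem_rowStochastic hLs
  have hz := (Finset.sum_eq_zero_iff_of_nonneg fun z _ =>
    mul_nonneg (hnn z) (sub_nonneg.2 (hy z (Finset.mem_univ z)))).1 hsum s (Finset.mem_univ s)
  rw [h0, sub_zero, mul_self_eq_zero] at hz
  exact le_antisymm (hz ▸ hy x (Finset.mem_univ x)) (Matrix.nonneg_of_mem_rowStochastic hLs)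

/-- A stationary vector vanishes at transient states. -/
lemma eq_zero_of_vecMul_eq_of_isTransient (hM : M ∈ Matrix.rowStochastic ℝ S) {μ : S → ℝ}
    (hμ : Matrix.vecMul μ M = μ) {s : S} (hs : IsTransient M s) : μ s = 0 := by
  rw [← vecMul_cesaroLimit hM hμ]
  simp [Matrix.vecMul, dotProduct, cesaroLimit_apply_eq_zero_of_isTransient hM hs]

/-- A nonempty set that is closed under `M` contains every irreducible class it meets. -/
lemma subset_of_isClosedClass {C Z : Set S} (hC : IsIrreducibleOn M C) (hZ : IsClosedClass M Z)
    {x : S} (hxC : x ∈ C) (hxZ : x ∈ Z) : C ⊆ Z := by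
  intro y hy
  by_contra hyZ
  have hp : ∀ n : ℕ, ∀ z ∉ Z, (M ^ n) x z = 0 := by
    intro n
    induction n with
    | zero => exact fun z hz => Matrix.one_apply_ne (by rintro rfl; exact hz hxZ)
    | succ n ih =>
      intro z hz
      rw [pow_succ, Matrix.mul_apply]
      refine Finset.sum_eq_zero fun w _ => ?_
      by_cases hw : w ∈ Z
      · rw [hZ w hw z hz, mul_zero]
      · rw [ih w hw, zero_mul]
  obtain ⟨n, hn⟩ := hC x hxC y hy
  exact hn.ne' (hp n y hyZ)

/-- If `R` is closed, the part of the support of a nonnegative stationary vector lying outside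
`R` is closed as well. -/
lemma isClosedClass_support_diff (hM : M ∈ Matrix.rowStochastic ℝ S) {μ : S → ℝ}
    (h0 : ∀ s, 0 ≤ μ s) (hμ : Matrix.vecMul μ M = μ) {R : Set S} (hR : IsClosedClass M R) :
    IsClosedClass M {s | μ s ≠ 0 ∧ s ∉ R} := by
  classical
  have hMn : ∀ i j, 0 ≤ M i j := hM.1
  intro x ⟨hx, hxR⟩ y hy
  by_cases hyR : y ∈ R
  · have hin : ∀ s, ∑ z, μ z * M z s = μ s := fun s => congrFun hμ s
    have h1 : ∑ s, (if s ∈ R then 0 else μ s)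
        = ∑ z, if z ∈ R then 0 else μ z * ∑ s, if s ∈ R then 0 else M z s := by
      simp_rw [Finset.mul_sum]
      have : ∀ s, (if s ∈ R then 0 else μ s)
          = ∑ z, if z ∈ R then 0 else μ z * (if s ∈ R then 0 else M z s) := by
        intro s
        split_ifs with hs
        · simp
        · rw [← hin s]
          refine Finset.sum_congr rfl fun z _ => ?_
          split_ifs with hz
          · rw [hR z hz s hs, mul_zero]
          · rfl
      simp_rw [this]
      rw [Finset.sum_comm]
      refine Finset.sum_congr rfl fun z _ => ?_
      split_ifs <;> simp
    have h2 : ∑ z, (if z ∈ R then 0 else μ z * ∑ s, if s ∈ R then M z s else 0) = 0 := by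
      have : ∀ z, (∑ s, if s ∈ R then M z s else 0)
          = 1 - ∑ s, if s ∈ R then 0 else M z s := by
        intro z
        rw [← Matrix.sum_row_of_mem_rowStochastic hM z, eq_sub_iff_add_eq, ← Finset.sum_add_distrib]
        refine Finset.sum_congr rfl fun s _ => ?_
        split_ifs <;> simp
      have h1' := sub_eq_zero.2 h1
      rw [← Finset.sum_sub_distrib] at h1'
      refine (Finset.sum_congr rfl fun z _ => ?_).trans h1'
      rw [this]
      split_ifs <;> ring
    have hnn : ∀ z s, 0 ≤ if s ∈ R then M z s else 0 := fun z s => by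
      split_ifs
      exacts [hMn z s, le_rfl]
    have h3 := (Finset.sum_eq_zero_iff_of_nonneg fun z _ => by
      split_ifs
      exacts [le_rfl, mul_nonneg (h0 z) (Finset.sum_nonneg fun s _ => hnn z s)]).1 h2 x
      (Finset.mem_univ x)
    rw [if_neg hxR] at h3
    have h4 := (Finset.sum_eq_zero_iff_of_nonneg fun s _ => hnn x s).1
      ((mul_eq_zero.1 h3).resolve_left hx) y (Finset.mem_univ y)
    simpa [hyR] using h4
  · refine isClosedClass_support hMn h0 hμ x hx y ?_
    intro hy'
    exact hy ⟨hy', hyR⟩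

end Cesaro

/-- The state marginal of a state-action vector. -/
def stateMarginal {S A : Type*} [Fintype A] (q : S × A → ℝ) (s : S) : ℝ :=
  ∑ a, q (s, a)

/-- The policy obtained by conditioning `q` on the state, with `π` used on states of zero mass. -/
def flowPolicy {S A : Type*} [Fintype A] (π : S → A → ℝ) (q : S × A → ℝ) : S → A → ℝ :=
  fun s a => if stateMarginal q s = 0 then π s a else q (s, a) / stateMarginal q s

lemma stateMarginal_mul {S A : Type*} [Fintype A] {π : S → A → ℝ} (hπ : IsPolicy π) (μ : S → ℝ) :
    stateMarginal (fun p : S × A => μ p.1 * π p.1 p.2) = μ := by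
  ext s
  simp [stateMarginal, ← Finset.mul_sum, hπ.2]

section Flow

variable {S A : Type*} [Fintype S] [Fintype A] {P : S → A → S → ℝ} {π : S → A → ℝ}
  {q : S × A → ℝ}

lemma markovMatrix_mem_rowStochastic [DecidableEq S] (hP : IsKernel P) (hπ : IsPolicy π) :
    markovMatrix P π ∈ Matrix.rowStochastic ℝ S := by
  rw [Matrix.mem_rowStochastic_iff_sum]
  refine ⟨fun s s' => Finset.sum_nonneg fun a _ => mul_nonneg (hπ.1 s a) (hP.1 s a s'),
    fun s => ?_⟩
  simp only [markovMatrix]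
  rw [Finset.sum_comm]
  simp [← Finset.mul_sum, hP.2, hπ.2]

lemma flow_eq_vecMul (P : S → A → S → ℝ) (π : S → A → ℝ) (μ : S → ℝ) (s : S) :
    ∑ p : S × A, P p.1 p.2 s * (μ p.1 * π p.1 p.2) = Matrix.vecMul μ (markovMatrix P π) s := by
  simp only [Matrix.vecMul, dotProduct, markovMatrix, Fintype.sum_prod_type, Finset.mul_sum]
  exact Finset.sum_congr rfl fun x _ => Finset.sum_congr rfl fun a _ => by ring

lemma mem_flowPolytope_of_stationary (hπ : IsPolicy π) {μ : S → ℝ} (h0 : ∀ s, 0 ≤ μ s)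
    (h1 : ∑ s, μ s = 1) (hμ : Matrix.vecMul μ (markovMatrix P π) = μ) :
    (fun p : S × A => μ p.1 * π p.1 p.2) ∈ flowPolytope P := by
  refine ⟨fun p => mul_nonneg (h0 _) (hπ.1 _ _), ?_, fun s => ?_⟩
  · simp [Fintype.sum_prod_type, ← Finset.mul_sum, hπ.2, h1]
  · rw [flow_eq_vecMul, hμ]
    simp [← Finset.mul_sum, hπ.2]

lemma stateMarginal_nonneg (hq : q ∈ flowPolytope P) (s : S) : 0 ≤ stateMarginal q s :=
  Finset.sum_nonneg fun _ _ => hq.1 _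

lemma sum_stateMarginal (hq : q ∈ flowPolytope P) : ∑ s, stateMarginal q s = 1 := by
  rw [← hq.2.1, Fintype.sum_prod_type]
  rfl

lemma exists_stateMarginal_ne_zero (hq : q ∈ flowPolytope P) : ∃ s, stateMarginal q s ≠ 0 := by
  by_contra! h
  have := sum_stateMarginal hq
  simp [h] at this

lemma apply_eq_zero_of_stateMarginal (hq : q ∈ flowPolytope P) {s : S}
    (hs : stateMarginal q s = 0) (a : A) : q (s, a) = 0 :=
  (Finset.sum_eq_zero_iff_of_nonneg fun _ _ => hq.1 _).1 hs a (Finset.mem_univ a)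

lemma vecMul_stateMarginal (hq : q ∈ flowPolytope P)
    (h : ∀ s a, q (s, a) = stateMarginal q s * π s a) :
    Matrix.vecMul (stateMarginal q) (markovMatrix P π) = stateMarginal q := by
  ext s
  rw [← flow_eq_vecMul]
  refine Eq.trans ?_ (hq.2.2 s).symm
  exact Finset.sum_congr rfl fun p _ => by rw [← h]

lemma isPolicy_flowPolicy (hπ : IsPolicy π) (hq : q ∈ flowPolytope P) :
    IsPolicy (flowPolicy π q) := by
  refine ⟨fun s a => ?_, fun s => ?_⟩
  · unfold flowPolicy
    split_ifs
    exacts [hπ.1 s a, div_nonneg (hq.1 _) (stateMarginal_nonneg hq s)]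
  · unfold flowPolicy
    split_ifs with h
    · exact hπ.2 s
    · rw [← Finset.sum_div]
      exact div_self h

lemma eq_stateMarginal_mul_flowPolicy (hq : q ∈ flowPolytope P) (s : S) (a : A) :
    q (s, a) = stateMarginal q s * flowPolicy π q s a := by
  unfold flowPolicy
  split_ifs with h
  · rw [apply_eq_zero_of_stateMarginal hq h, h, zero_mul]
  · rw [mul_div_cancel₀ _ h]

lemma convex_flowPolytope (P : S → A → S → ℝ) : Convex ℝ (flowPolytope P) := by
  intro q hq q' hq' α β hα hβ hαβ
  refine ⟨fun p => ?_, ?_, fun s => ?_⟩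
  · exact add_nonneg (mul_nonneg hα (hq.1 p)) (mul_nonneg hβ (hq'.1 p))
  · simp [Finset.sum_add_distrib, ← Finset.mul_sum, hq.2.1, hq'.2.1, hαβ]
  · have h := hq.2.2 s
    have h' := hq'.2.2 s
    simp only [Pi.add_apply, Pi.smul_apply, smul_eq_mul, Finset.sum_add_distrib, mul_add,
      ← Finset.mul_sum, mul_left_comm _ α, mul_left_comm _ β]
    rw [h, h']

/-- If the support of `q'` is contained in that of `q`, then `q` lies strictly between `q'` and a
flow whose support is strictly smaller than that of `q`. -/
lemma exists_split_of_support_subset {q' : S × A → ℝ} (hq : q ∈ flowPolytope P)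
    (hq' : q' ∈ flowPolytope P) (hne : q ≠ q') (hsupp : ∀ p, q p = 0 → q' p = 0) :
    ∃ t : ℝ, 0 ≤ t ∧ t < 1 ∧ ∃ q'' ∈ flowPolytope P, q = t • q' + (1 - t) • q'' ∧
      (∀ p, q p = 0 → q'' p = 0) ∧ ∃ p, q p ≠ 0 ∧ q'' p = 0 := by
  have hT : (Finset.univ.filter fun p => q' p ≠ 0).Nonempty := by
    by_contra h
    have h2 := hq'.2.1
    rw [Finset.not_nonempty_iff_eq_empty, Finset.filter_eq_empty_iff] at h
    simp only [Finset.mem_univ, true_implies, not_not] at h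
    simp [h] at h2
  obtain ⟨p₀, hp₀, hmin⟩ := Finset.exists_min_image _ (fun p => q p / q' p) hT
  simp only [Finset.mem_filter, Finset.mem_univ, true_and] at hp₀ hmin
  set t := q p₀ / q' p₀ with ht
  have ht0 : 0 ≤ t := div_nonneg (hq.1 _) (hq'.1 _)
  have hle : ∀ p, t * q' p ≤ q p := by
    intro p
    by_cases hp : q' p = 0
    · rw [hp, mul_zero]
      exact hq.1 p
    · exact (le_div_iff₀ (lt_of_le_of_ne (hq'.1 p) (Ne.symm hp))).1 (hmin p hp)
  have hsum : ∑ p, (q p - t * q' p) = 1 - t := by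
    rw [Finset.sum_sub_distrib, ← Finset.mul_sum, hq.2.1, hq'.2.1, mul_one]
  have hnn : ∀ p ∈ Finset.univ, 0 ≤ q p - t * q' p := fun p _ => sub_nonneg.2 (hle p)
  have ht1 : t < 1 := by
    have h : 0 ≤ 1 - t := hsum ▸ Finset.sum_nonneg hnn
    refine lt_of_le_of_ne (by linarith) fun h1 => hne ?_
    rw [h1, sub_self] at hsum
    ext p
    have := (Finset.sum_eq_zero_iff_of_nonneg (by simpa [h1] using hnn)).1 hsum p
      (Finset.mem_univ p)
    linarith
  have h1t : 0 < 1 - t := by linarith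
  have hp₀q : q p₀ - t * q' p₀ = 0 := by
    rw [ht, div_mul_cancel₀ _ hp₀, sub_self]
  refine ⟨t, ht0, ht1, fun p => (q p - t * q' p) / (1 - t), ⟨fun p => ?_, ?_, fun s => ?_⟩, ?_,
    fun p hp => ?_, p₀, fun h => hp₀ (hsupp p₀ h), ?_⟩
  · exact div_nonneg (hnn p (Finset.mem_univ p)) h1t.le
  · rw [← Finset.sum_div, hsum, div_self h1t.ne']
  · simp only [← Finset.sum_div, mul_div_assoc', mul_sub, Finset.sum_sub_distrib, ← Finset.mul_sum,
      mul_left_comm _ t]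
    rw [hq.2.2 s, hq'.2.2 s]
  · ext p
    simp only [Pi.add_apply, Pi.smul_apply, smul_eq_mul]
    rw [mul_div_cancel₀ _ h1t.ne']
    ring
  · simp [hp, hsupp p hp]
  · simp [hp₀q]

/-- The flows of minimal support: no other flow is supported in the support of such a flow. -/
def minimalFlows (P : S → A → S → ℝ) : Set (S × A → ℝ) :=
  {q | q ∈ flowPolytope P ∧ ∀ q' ∈ flowPolytope P, (∀ p, q p = 0 → q' p = 0) → q' = q}

lemma finite_minimalFlows (P : S → A → S → ℝ) : (minimalFlows P).Finite := by
  refine Set.Finite.of_finite_image (f := fun q => {p | q p = 0}) (Set.toFinite _) ?_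
  intro q hq q' hq' h
  exact hq'.2 q hq.1 fun p hp => (Set.ext_iff.1 h p).2 hp

lemma flowPolytope_subset_convexHull (P : S → A → S → ℝ) :
    flowPolytope P ⊆ convexHull ℝ (minimalFlows P) := by
  suffices H : ∀ n : ℕ, ∀ q ∈ flowPolytope P, {p | q p ≠ 0}.ncard = n →
      q ∈ convexHull ℝ (minimalFlows P) from fun q hq => H _ q hq rfl
  intro n
  induction n using Nat.strong_induction_on with
  | _ n ih =>
    intro q hq hn
    by_cases hmin : q ∈ minimalFlows P
    · exact subset_convexHull ℝ _ hmin
    have hsmall : ∀ q' ∈ flowPolytope P, (∀ p, q p = 0 → q' p = 0) →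
        (∃ p, q p ≠ 0 ∧ q' p = 0) → q' ∈ convexHull ℝ (minimalFlows P) := by
      rintro q' hq' hs ⟨p, hp, hp'⟩
      refine ih _ ?_ q' hq' rfl
      rw [← hn]
      refine Set.ncard_lt_ncard ⟨fun x hx h => hx (hs x h), fun h => h hp hp'⟩ (Set.toFinite _)
    obtain ⟨q', hq', hs, hne⟩ : ∃ q' ∈ flowPolytope P, (∀ p, q p = 0 → q' p = 0) ∧ q' ≠ q := by
      by_contra! h
      exact hmin ⟨hq, h⟩
    obtain ⟨-, -, -, q₁, hq₁, -, hs₁, p, hp, hp₁⟩ :=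
      exists_split_of_support_subset hq hq' hne.symm hs
    have hne₁ : q ≠ q₁ := fun h => hp (h ▸ hp₁)
    obtain ⟨t, ht0, ht1, q₂, hq₂, heq, hs₂, hlt₂⟩ :=
      exists_split_of_support_subset hq hq₁ hne₁ hs₁
    rw [heq]
    exact convex_convexHull ℝ _ (hsmall q₁ hq₁ hs₁ ⟨p, hp, hp₁⟩) (hsmall q₂ hq₂ hs₂ hlt₂) ht0
      (by linarith) (by ring)

end Flow

section Occupation

variable {S A : Type*} [Fintype S] [DecidableEq S] [Fintype A] {P : S → A → S → ℝ}
  {π : S → A → ℝ} {q : S × A → ℝ} {C : Set S}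

lemma isOccupation_cesaroLimit (hP : IsKernel P) (hπ : IsPolicy π) (s₁ : S) :
    IsOccupation P π s₁ fun p => cesaroLimit (markovMatrix P π) s₁ p.1 * π p.1 p.2 := by
  intro s a
  have h := (tendsto_cesaroLimit_apply (markovMatrix_mem_rowStochastic hP hπ) s₁ s).mul_const
    (π s a)
  simpa only [cesaroMean_apply, mul_assoc, Finset.sum_mul] using h

lemma cesaroLimit_mem_flowPolytope (hP : IsKernel P) (hπ : IsPolicy π) (s₁ : S) :
    (fun p : S × A => cesaroLimit (markovMatrix P π) s₁ p.1 * π p.1 p.2) ∈ flowPolytope P := by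
  have hM := markovMatrix_mem_rowStochastic hP hπ
  exact mem_flowPolytope_of_stationary hπ
    (fun s => Matrix.nonneg_of_mem_rowStochastic (cesaroLimit_mem hM))
    (Matrix.sum_row_of_mem_rowStochastic (cesaroLimit_mem hM) s₁) (cesaroLimit_vecMul hM s₁)

lemma occSet_subset_flowPolytope (hP : IsKernel P) (s₁ : S) : occSet P s₁ ⊆ flowPolytope P := by
  rintro q ⟨π, hπ, hq⟩
  have : q = fun p => cesaroLimit (markovMatrix P π) s₁ p.1 * π p.1 p.2 := by
    ext ⟨s, a⟩
    exact tendsto_nhds_unique (hq s a) (isOccupation_cesaroLimit hP hπ s₁ s a)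
  exact this ▸ cesaroLimit_mem_flowPolytope hP hπ s₁

lemma stateMarginal_eq_zero_of_notMem (hP : IsKernel P) (hπ : IsPolicy π)
    (htr : ∀ s ∉ C, ∀ π' : S → A → ℝ, IsPolicy π' → IsTransient (markovMatrix P π') s)
    (hq : q ∈ flowPolytope P) {s : S} (hs : s ∉ C) : stateMarginal q s = 0 := by
  have hπ' := isPolicy_flowPolicy hπ hq
  exact eq_zero_of_vecMul_eq_of_isTransient (markovMatrix_mem_rowStochastic hP hπ')
    (vecMul_stateMarginal hq (eq_stateMarginal_mul_flowPolicy hq)) (htr s hs _ hπ')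

/-- A flow that is the only one generated by its own policy is an occupation measure. -/
lemma mem_occSet_of_unique (hP : IsKernel P) (hπ : IsPolicy π)
    (hirr : IsIrreducibleOn (markovMatrix P π) C)
    (htr : ∀ s ∉ C, ∀ π' : S → A → ℝ, IsPolicy π' → IsTransient (markovMatrix P π') s)
    (s₁ : S) (hq : q ∈ flowPolytope P)
    (huniq : ∀ q' ∈ flowPolytope P, (∀ s a, q' (s, a) = stateMarginal q' s * flowPolicy π q s a) →
      (∀ p, q p = 0 → q' p = 0) → q' = q) : q ∈ occSet P s₁ := by
  have hπ' := isPolicy_flowPolicy hπ hq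
  have hM := markovMatrix_mem_rowStochastic hP hπ'
  have hq' := cesaroLimit_mem_flowPolytope hP hπ' s₁
  set μ := cesaroLimit (markovMatrix P (flowPolicy π q)) s₁ with hμ
  have hmarg := stateMarginal_mul hπ' μ
  have hR : IsClosedClass (markovMatrix P (flowPolicy π q)) {s | stateMarginal q s ≠ 0} :=
    isClosedClass_support hM.1 (stateMarginal_nonneg hq)
      (vecMul_stateMarginal hq (eq_stateMarginal_mul_flowPolicy hq))
  have hZ := isClosedClass_support_diff hM
    (fun s => Matrix.nonneg_of_mem_rowStochastic (cesaroLimit_mem hM))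
    (cesaroLimit_vecMul hM s₁) hR
  rw [← hμ] at hZ
  have hZ' : IsClosedClass (markovMatrix P π)
      {s | μ s ≠ 0 ∧ s ∉ {s | stateMarginal q s ≠ 0}} := by
    intro x hx y hy
    rw [← hZ x hx y hy]
    have : stateMarginal q x = 0 := by simpa using hx.2
    simp [markovMatrix, flowPolicy, this]
  have hsupp : ∀ s, stateMarginal q s = 0 → μ s = 0 := by
    intro s hs
    by_contra hμs
    have hsC : s ∈ C := by
      by_contra hsC
      exact hμs (by simpa [hmarg] using stateMarginal_eq_zero_of_notMem hP hπ htr hq' hsC)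
    have hCZ := subset_of_isClosedClass hirr hZ' hsC ⟨hμs, by simpa using hs⟩
    obtain ⟨y, hy⟩ := exists_stateMarginal_ne_zero hq
    have hyC : y ∈ C := by
      by_contra hyC
      exact hy (stateMarginal_eq_zero_of_notMem hP hπ htr hq hyC)
    exact (hCZ hyC).2 hy
  refine ⟨flowPolicy π q, hπ', ?_⟩
  have := huniq _ hq' (fun s a => by rw [hmarg]) ?_
  · intro s a
    rw [← congrFun this (s, a)]
    exact isOccupation_cesaroLimit hP hπ' s₁ s a
  · rintro ⟨s, a⟩ hp
    by_cases hs : stateMarginal q s = 0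
    · simp [hsupp s hs]
    · simp [flowPolicy, hs, hp]

lemma minimalFlows_subset_occSet (hP : IsKernel P) (hπ : IsPolicy π)
    (hirr : IsIrreducibleOn (markovMatrix P π) C)
    (htr : ∀ s ∉ C, ∀ π' : S → A → ℝ, IsPolicy π' → IsTransient (markovMatrix P π') s)
    (s₁ : S) : minimalFlows P ⊆ occSet P s₁ := fun _ hq =>
  mem_occSet_of_unique hP hπ hirr htr s₁ hq.1 fun q' hq' _ h => hq.2 q' hq' h

/-- A flow giving positive mass to every pair `(s, a)` with `s ∈ C` and `π s a ≠ 0` is an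
occupation measure. -/
lemma mem_occSet_of_pos (hP : IsKernel P) (hπ : IsPolicy π)
    (hirr : IsIrreducibleOn (markovMatrix P π) C)
    (htr : ∀ s ∉ C, ∀ π' : S → A → ℝ, IsPolicy π' → IsTransient (markovMatrix P π') s)
    (s₁ : S) (hq : q ∈ flowPolytope P)
    (hpos : ∀ s ∈ C, ∀ a, π s a ≠ 0 → q (s, a) ≠ 0) : q ∈ occSet P s₁ := by
  have hπ' := isPolicy_flowPolicy hπ hq
  have hM := markovMatrix_mem_rowStochastic hP hπ'
  refine mem_occSet_of_unique hP hπ hirr htr s₁ hq fun q' hq' hqq' hs => ?_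
  by_contra hne
  obtain ⟨t, -, ht1, q₂, hq₂, heq, -, ⟨s, a⟩, hp, hp₂⟩ :=
    exists_split_of_support_subset hq hq' (Ne.symm hne) hs
  have h1t : 1 - t ≠ 0 := by linarith
  have happ : ∀ p, q p = t * q' p + (1 - t) * q₂ p := fun p => congrFun heq p
  have hmarg : ∀ s, stateMarginal q s = t * stateMarginal q' s + (1 - t) * stateMarginal q₂ s := by
    intro s
    simp only [stateMarginal, happ, Finset.sum_add_distrib, Finset.mul_sum]
  have hq₂π : ∀ s a, q₂ (s, a) = stateMarginal q₂ s * flowPolicy π q s a := by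
    intro s a
    have h := eq_stateMarginal_mul_flowPolicy (π := π) hq s a
    rw [happ, hqq', hmarg] at h
    refine mul_left_cancel₀ h1t ?_
    linear_combination h
  have hZ : IsClosedClass (markovMatrix P (flowPolicy π q)) {s | stateMarginal q₂ s ≠ 0} :=
    isClosedClass_support hM.1 (stateMarginal_nonneg hq₂) (vecMul_stateMarginal hq₂ hq₂π)
  have hZC : ∀ {q}, q ∈ flowPolytope P → ∀ s, stateMarginal q s ≠ 0 → s ∈ C := by
    intro q hq s hs
    by_contra hsC
    exact hs (stateMarginal_eq_zero_of_notMem hP hπ htr hq hsC)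
  have hZ' : IsClosedClass (markovMatrix P π) {s | stateMarginal q₂ s ≠ 0} := by
    intro x hx y hy
    have hsum : ∑ a, flowPolicy π q x a * P x a y = 0 := hZ x hx y hy
    refine Finset.sum_eq_zero fun a _ => ?_
    by_cases hπa : π x a = 0
    · rw [hπa, zero_mul]
    have hqa := hpos x (hZC hq₂ x hx) a hπa
    rw [eq_stateMarginal_mul_flowPolicy (π := π) hq] at hqa
    have h0 := (Finset.sum_eq_zero_iff_of_nonneg fun a _ =>
      mul_nonneg (hπ'.1 x a) (hP.1 x a y)).1 hsum a (Finset.mem_univ a)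
    rw [(mul_eq_zero.1 h0).resolve_left (right_ne_zero_of_mul hqa), mul_zero]
  obtain ⟨x, hx⟩ := exists_stateMarginal_ne_zero hq₂
  have hCZ := subset_of_isClosedClass hirr hZ' (hZC hq₂ x hx) hx
  rw [eq_stateMarginal_mul_flowPolicy (π := π) hq] at hp
  rw [hq₂π] at hp₂
  exact (mul_eq_zero.1 hp₂).elim (hCZ (hZC hq s (left_ne_zero_of_mul hp)))
    (right_ne_zero_of_mul hp)

/-- In a weakly communicating MDP, occupation measures are dense in the flow polytope. -/
lemma flowPolytope_subset_closure_occSet (hP : IsKernel P) (hwc : WeaklyCommunicating P) (s₁ : S) :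
    flowPolytope P ⊆ closure (occSet P s₁) := by
  obtain ⟨π, C, hπ, ⟨c, hc⟩, -, hirr, htr⟩ := hwc
  have hM := markovMatrix_mem_rowStochastic hP hπ
  have hρ := cesaroLimit_mem_flowPolytope hP hπ c
  set μ := cesaroLimit (markovMatrix P π) c with hμ
  have hμ0 : ∀ s, 0 ≤ μ s := fun s => Matrix.nonneg_of_mem_rowStochastic (cesaroLimit_mem hM)
  have hμpos : ∀ s ∈ C, μ s ≠ 0 := by
    have hZ := isClosedClass_support hM.1 hμ0 (cesaroLimit_vecMul hM c)
    obtain ⟨x, hx⟩ := exists_stateMarginal_ne_zero hρ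
    have hxC : x ∈ C := by
      by_contra hxC
      exact hx (stateMarginal_eq_zero_of_notMem hP hπ htr hρ hxC)
    rw [stateMarginal_mul hπ] at hx
    exact subset_of_isClosedClass hirr hZ hxC hx
  intro q hq
  set ρ : S × A → ℝ := fun p => μ p.1 * π p.1 p.2
  have hlim : Tendsto (fun ε : ℝ => (1 - ε) • q + ε • ρ) (𝓝[>] 0) (𝓝 q) := by
    have : Continuous fun ε : ℝ => (1 - ε) • q + ε • ρ := by fun_prop
    simpa using (this.tendsto 0).mono_left nhdsWithin_le_nhds
  refine mem_closure_of_tendsto hlim ?_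
  filter_upwards [Ioo_mem_nhdsGT (zero_lt_one' ℝ)] with ε hε
  refine mem_occSet_of_pos hP hπ hirr htr s₁
    (convex_flowPolytope P hq hρ (by linarith [hε.2]) hε.1.le (by ring)) fun s hs a ha => ?_
  have h1 : 0 < ρ (s, a) := lt_of_le_of_ne (hρ.1 _) (mul_ne_zero (hμpos s hs) ha).symm
  have h2 : 0 ≤ (1 - ε) * q (s, a) := mul_nonneg (by linarith [hε.2]) (hq.1 _)
  have h3 : 0 < ε * ρ (s, a) := mul_pos hε.1 h1
  exact (add_pos_of_nonneg_of_pos h2 h3).ne'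

end Occupation

/-- A one-constraint Lagrange multiplier for finitely many points in the plane. -/
lemma exists_multiplier {ι : Type*} {F : Set ι} (hF : F.Finite) (u v : ι → ℝ)
    (h0 : ∀ i ∈ F, 0 ≤ u i → v i ≤ 0)
    (h1 : ∀ i ∈ F, ∀ j ∈ F, 0 < u i → u j < 0 → u i * v j ≤ u j * v i) :
    ∃ l : ℝ, 0 ≤ l ∧ ∀ i ∈ F, v i + l * u i ≤ 0 := by
  by_cases hall : ∀ j ∈ F, u j < 0 → v j ≤ 0
  · refine ⟨0, le_rfl, fun i hi => ?_⟩
    rw [zero_mul, add_zero]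
    exact (lt_or_ge (u i) 0).elim (hall i hi) (h0 i hi)
  push Not at hall
  obtain ⟨k, hk, huk, hvk⟩ := hall
  obtain ⟨j, ⟨hj, huj⟩, hmax⟩ := Set.exists_max_image {i ∈ F | u i < 0} (fun i => v i / -u i)
    (hF.subset fun i hi => hi.1) ⟨k, hk, huk⟩
  have hl : 0 ≤ v j / -u j :=
    (div_nonneg hvk.le (neg_nonneg.2 huk.le)).trans (hmax k ⟨hk, huk⟩)
  refine ⟨v j / -u j, hl, fun i hi => ?_⟩
  rcases lt_trichotomy (u i) 0 with hu | hu | hu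
  · have := (div_le_iff₀ (neg_pos.2 hu)).1 (hmax i ⟨hi, hu⟩)
    linarith
  · rw [hu, mul_zero, add_zero]
    exact h0 i hi hu.ge
  · have h := h1 i hi j hj hu huj
    have h2 : v j / -u j * u i ≤ -v i := by
      rw [div_mul_eq_mul_div, div_le_iff₀ (neg_pos.2 huj)]
      linarith
    linarith

section Duality

variable {S A : Type*} [Fintype S] [Fintype A]

lemma dotSA_combo (c q q' : S × A → ℝ) (α β : ℝ) :
    dotSA c (α • q + β • q') = α * dotSA c q + β * dotSA c q' := by
  simp only [dotSA, Finset.mul_sum, ← Finset.sum_add_distrib, Pi.add_apply, Pi.smul_apply,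
    smul_eq_mul]
  exact Finset.sum_congr rfl fun p _ => by ring

lemma continuous_dotSA (c : S × A → ℝ) : Continuous (dotSA c) :=
  continuous_finsetSum _ fun p _ => continuous_const.mul (continuous_apply p)

lemma dotSA_le_one {P : S → A → S → ℝ} {c q : S × A → ℝ} (hc : ∀ p, c p ∈ Set.Icc (0 : ℝ) 1)
    (hq : q ∈ flowPolytope P) : dotSA c q ≤ 1 := by
  rw [← hq.2.1]
  exact Finset.sum_le_sum fun p _ => mul_le_of_le_one_left (hq.1 p) (hc p).2

end Duality

/-- **Strong duality for weakly communicating average-reward CMDPs.**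
If the CMDP is feasible, there exists an optimal dual variable `λ* ≥ 0` attaining
`inf_{λ ≥ 0} D(λ)`, and the primal value `J*` equals `D(λ*)`. -/
theorem strong_duality_weakly_communicating
    {S A : Type*} [Fintype S] [DecidableEq S] [Fintype A] [Nonempty S] [Nonempty A]
    (P : S → A → S → ℝ) (hP : IsKernel P) (hwc : WeaklyCommunicating P)
    (s₁ : S) (r g : S × A → ℝ)
    (hr : ∀ p, r p ∈ Set.Icc (0 : ℝ) 1) (hg : ∀ p, g p ∈ Set.Icc (0 : ℝ) 1)
    (b : ℝ) (hb : b ∈ Set.Icc (0 : ℝ) 1)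
    (hfeas : ∃ q ∈ occSet P s₁, b ≤ dotSA g q) :
    ∃ lamStar : ℝ, 0 ≤ lamStar ∧
      dualFn P s₁ r g b lamStar = sInf (dualFn P s₁ r g b '' {l : ℝ | 0 ≤ l}) ∧
      sSup {x | ∃ q ∈ occSet P s₁, b ≤ dotSA g q ∧ x = dotSA r q} =
        dualFn P s₁ r g b lamStar := by
  have hQP := occSet_subset_flowPolytope hP s₁
  obtain ⟨q₀, hq₀, hbq₀⟩ := hfeas
  set J := sSup {x | ∃ q ∈ occSet P s₁, b ≤ dotSA g q ∧ x = dotSA r q} with hJ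
  have hJle : ∀ q ∈ occSet P s₁, b ≤ dotSA g q → dotSA r q ≤ J := by
    intro q hq hbq
    refine le_csSup ⟨1, ?_⟩ ⟨q, hq, hbq, rfl⟩
    rintro x ⟨q, hq, -, rfl⟩
    exact dotSA_le_one hr (hQP hq)
  have hJflow : ∀ q ∈ flowPolytope P, b < dotSA g q → dotSA r q ≤ J := by
    intro q hq hbq
    by_contra! h
    have hopen : IsOpen {q : S × A → ℝ | b < dotSA g q ∧ J < dotSA r q} :=
      (isOpen_lt continuous_const (continuous_dotSA g)).inter
        (isOpen_lt continuous_const (continuous_dotSA r))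
    obtain ⟨q', ⟨h1, h2⟩, hq'⟩ :=
      mem_closure_iff.1 (flowPolytope_subset_closure_occSet hP hwc s₁ hq) _ hopen ⟨hbq, h⟩
    exact h2.not_ge (hJle q' hq' h1.le)
  have hext : minimalFlows P ⊆ occSet P s₁ := by
    obtain ⟨π, C, hπ, -, -, hirr, htr⟩ := hwc
    exact minimalFlows_subset_occSet hP hπ hirr htr s₁
  obtain ⟨l, hl, hlF⟩ := exists_multiplier (finite_minimalFlows P)
    (fun q => dotSA g q - b) (fun q => dotSA r q - J)
    (fun q hq h => sub_nonpos.2 (hJle q (hext hq) (sub_nonneg.1 h))) <| by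
      intro q hq q' hq' hu hu'
      set u := dotSA g q - b with hudef
      set u' := dotSA g q' - b with hu'def
      have key : ∀ δ > 0, u * (dotSA r q' - J) + (δ - u') * (dotSA r q - J) ≤ 0 := by
        intro δ hδ
        have hw : 0 < δ - u' + u := by linarith
        have hmem := convex_flowPolytope P hq.1 hq'.1
          (div_nonneg (by linarith : 0 ≤ δ - u') hw.le) (div_nonneg hu.le hw.le)
          (by rw [← add_div, div_self hw.ne'])
        have hg' := hJflow _ hmem
        rw [dotSA_combo, dotSA_combo, div_mul_eq_mul_div, div_mul_eq_mul_div, ← add_div,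
          div_mul_eq_mul_div, div_mul_eq_mul_div, ← add_div, lt_div_iff₀ hw, div_le_iff₀ hw] at hg'
        have hpos : 0 < δ * u := mul_pos hδ hu
        have := hg' (by
          have h1 : dotSA g q = u + b := by ring
          have h2 : dotSA g q' = u' + b := by ring
          rw [h1, h2]
          nlinarith)
        nlinarith
      have hlim : Tendsto (fun δ : ℝ => u * (dotSA r q' - J) + (δ - u') * (dotSA r q - J))
          (𝓝[>] 0) (𝓝 (u * (dotSA r q' - J) + (0 - u') * (dotSA r q - J))) := by
        refine (Continuous.tendsto ?_ 0).mono_left nhdsWithin_le_nhds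
        fun_prop
      have := le_of_tendsto hlim (eventually_mem_nhdsWithin.mono key)
      linarith
  have hlP : ∀ q ∈ flowPolytope P, dotSA r q + l * (dotSA g q - b) ≤ J := by
    intro q hq
    have hconv : Convex ℝ {q : S × A → ℝ | dotSA r q + l * (dotSA g q - b) ≤ J} := by
      intro x hx y hy α β hα hβ hαβ
      simp only [Set.mem_ofPred_eq, dotSA_combo] at hx hy ⊢
      obtain rfl : β = 1 - α := by linarith
      nlinarith [mul_le_mul_of_nonneg_left hx hα, mul_le_mul_of_nonneg_left hy hβ]
    refine convexHull_min (fun q hq => ?_) hconv (flowPolytope_subset_convexHull P hq)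
    have := hlF q hq
    simp only [Set.mem_ofPred_eq]
    linarith
  have hweak : ∀ m : ℝ, 0 ≤ m → J ≤ dualFn P s₁ r g b m := by
    intro m hm
    refine csSup_le ⟨_, q₀, hq₀, hbq₀, rfl⟩ ?_
    rintro x ⟨q, hq, hbq, rfl⟩
    refine le_trans (le_add_of_nonneg_right (mul_nonneg hm (sub_nonneg.2 hbq)))
      (le_csSup ⟨1 + m, ?_⟩ ⟨q, hq, rfl⟩)
    rintro x ⟨q, hq, rfl⟩
    have h1 := dotSA_le_one hr (hQP hq)
    have h2 := dotSA_le_one hg (hQP hq)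
    have h3 : m * (dotSA g q - b) ≤ m * 1 :=
      mul_le_mul_of_nonneg_left (by linarith [hb.1]) hm
    linarith
  have heq : dualFn P s₁ r g b l = J := by
    refine le_antisymm (csSup_le ⟨_, q₀, hq₀, rfl⟩ ?_) (hweak l hl)
    rintro x ⟨q, hq, rfl⟩
    exact hlP q (hQP hq)
  have hleast : IsLeast (dualFn P s₁ r g b '' {l : ℝ | 0 ≤ l}) (dualFn P s₁ r g b l) := by
    refine ⟨⟨l, hl, rfl⟩, ?_⟩
    rintro x ⟨m, hm, rfl⟩
    rw [heq]
    exact hweak m hm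
  exact ⟨l, hl, hleast.csInf_eq.symm, heq.symm⟩
end
end

section
/- Optimism of the clipped value function estimates: Suppose that for all (s, a) ∈ S × A and all h ∈ {1, …, H}, |⟪φ(s,a), w_{h+1}⟫ − (P V_{h+1}(s,a) − min_{s'} V_{h+1}(s'))| ≤ β · ‖φ(s,a)‖_{Σ⁻¹}, and suppose that sp(V^{π*}_{r,h} + λ · V^{π*}_{g,h}) ≤ 2ζ for all h ∈ {1, …, H}. Then for all s ∈ S and all h ∈ {1, …, H+1}, V^{π*}_{r,h}(s) + λ · V^{π*}_{g,h}(s) ≤ V_h(s). -/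
open Finset Matrix

noncomputable section

theorem sum_weight_mul_le_of_le {ι : Type*} [Fintype ι] {p f : ι → ℝ} {c : ℝ}
    (hp0 : ∀ i, 0 ≤ p i) (hp1 : ∑ i, p i = 1) (hf : ∀ i, f i ≤ c) :
    ∑ i, p i * f i ≤ c :=
  calc ∑ i, p i * f i ≤ ∑ i, p i * c :=
        Finset.sum_le_sum fun i _ => mul_le_mul_of_nonneg_left (hf i) (hp0 i)
    _ = c := by rw [← Finset.sum_mul, hp1, one_mul]

theorem le_min_ciInf_add_of_span_le {S : Type*} [Finite S] [Nonempty S] {U W : S → ℝ} {c : ℝ}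
    (hUW : ∀ s, U s ≤ W s) (hU : (⨆ s, U s) - (⨅ s, U s) ≤ c) (s : S) :
    U s ≤ min (W s) ((⨅ s', W s') + c) := by
  have hsup : U s ≤ ⨆ s, U s := le_ciSup (Set.finite_range U).bddAbove s
  have hinf : (⨅ s, U s) ≤ ⨅ s, W s := ciInf_mono (Set.finite_range U).bddBelow hUW
  exact le_min (hUW s) (by linarith)

/-- **Optimism of the clipped value function estimates.**
Given the backward recursion with clipping parameter `ζ`, if the concentration event holds
and the span of the composite optimal value functions is bounded by `2ζ`, then the clipped
value estimates upper-bound the composite value functions of the policy `π*`. -/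
theorem clipped_value_optimism
    {S A : Type*} [Fintype S] [Fintype A] [Nonempty S] [Nonempty A]
    (H : ℕ) (hH : 1 ≤ H) (d : ℕ) (hd : 0 < d)
    (P : S → A → S → ℝ)
    (hP0 : ∀ s a s', 0 ≤ P s a s') (hP1 : ∀ s a, ∑ s', P s a s' = 1)
    (r g : S → A → ℝ)
    (hr : ∀ s a, r s a ∈ Set.Icc (0 : ℝ) 1) (hg : ∀ s a, g s a ∈ Set.Icc (0 : ℝ) 1)
    (φ : S → A → (Fin d → ℝ))
    (Sig : Matrix (Fin d) (Fin d) ℝ) (hSig : Sig.PosDef)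
    (γ : ℝ) (hγ : 0 < γ) (lam : ℝ) (hlam : lam ∈ Set.Icc 0 (2 / γ))
    (β : ℝ) (hβ : 0 ≤ β) (ζ : ℝ) (hζ : 0 ≤ ζ)
    (w : ℕ → (Fin d → ℝ))
    -- the backward recursion defining `Q_h`, `Ṽ_h`, `V_h`
    (Qf : ℕ → S → A → ℝ) (Vt V : ℕ → S → ℝ)
    (hVtop : ∀ s, V (H + 1) s = 0)
    (hQ : ∀ h ∈ Finset.Icc 1 H, ∀ s a, Qf h s a =
      min (r s a + lam * g s a + (∑ i, φ s a i * w (h + 1) i) + (⨅ s', V (h + 1) s')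
          + β * Real.sqrt (φ s a ⬝ᵥ (Sig⁻¹ *ᵥ φ s a)))
        ((1 + 2 / γ) * (H : ℝ)))
    (hVt : ∀ h ∈ Finset.Icc 1 H, ∀ s, Vt h s = ⨆ a, Qf h s a)
    (hV : ∀ h ∈ Finset.Icc 1 H, ∀ s, V h s = min (Vt h s) ((⨅ s', Vt h s') + 2 * ζ))
    -- the stationary randomized policy `π*` and its finite-horizon value functions
    (πs : S → A → ℝ) (hπ0 : ∀ s a, 0 ≤ πs s a) (hπ1 : ∀ s, ∑ a, πs s a = 1)
    (Vr Vg : ℕ → S → ℝ)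
    (hVrtop : ∀ s, Vr (H + 1) s = 0) (hVgtop : ∀ s, Vg (H + 1) s = 0)
    (hVr : ∀ h ∈ Finset.Icc 1 H, ∀ s,
      Vr h s = ∑ a, πs s a * (r s a + ∑ s', P s a s' * Vr (h + 1) s'))
    (hVg : ∀ h ∈ Finset.Icc 1 H, ∀ s,
      Vg h s = ∑ a, πs s a * (g s a + ∑ s', P s a s' * Vg (h + 1) s'))
    -- concentration hypothesis
    (hconc : ∀ h ∈ Finset.Icc 1 H, ∀ s a,
      |(∑ i, φ s a i * w (h + 1) i) -
          ((∑ s', P s a s' * V (h + 1) s') - ⨅ s', V (h + 1) s')|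
        ≤ β * Real.sqrt (φ s a ⬝ᵥ (Sig⁻¹ *ᵥ φ s a)))
    -- span hypothesis
    (hspan : ∀ h ∈ Finset.Icc 1 H,
      (⨆ s, (Vr h s + lam * Vg h s)) - (⨅ s, (Vr h s + lam * Vg h s)) ≤ 2 * ζ) :
    ∀ h ∈ Finset.Icc 1 (H + 1), ∀ s, Vr h s + lam * Vg h s ≤ V h s := by
  have hK : 0 ≤ 2 / γ := by positivity
  have hrec : ∀ h ∈ Finset.Icc 1 H, ∀ s, Vr h s + lam * Vg h s = ∑ a, πs s a *
      (r s a + lam * g s a + ∑ s', P s a s' * (Vr (h + 1) s' + lam * Vg (h + 1) s')) := by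
    intro h hh s
    rw [hVr h hh, hVg h hh, Finset.mul_sum, ← Finset.sum_add_distrib]
    refine Finset.sum_congr rfl fun a _ => ?_
    have hlin : ∑ s', P s a s' * (Vr (h + 1) s' + lam * Vg (h + 1) s') =
        ∑ s', P s a s' * Vr (h + 1) s' + lam * ∑ s', P s a s' * Vg (h + 1) s' := by
      rw [Finset.mul_sum, ← Finset.sum_add_distrib]
      exact Finset.sum_congr rfl fun s' _ => by ring
    rw [hlin]
    ring
  have hcost : ∀ s a, r s a + lam * g s a ≤ 1 + 2 / γ := fun s a =>
    add_le_add (hr s a).2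
      ((mul_le_of_le_one_right hlam.1 (hg s a).2).trans hlam.2)
  have key : ∀ k h : ℕ, 1 ≤ h → h + k = H + 1 → ∀ s,
      Vr h s + lam * Vg h s ≤ V h s ∧ Vr h s + lam * Vg h s ≤ (1 + 2 / γ) * k := by
    intro k
    induction k with
    | zero =>
      intro h _ hk s
      obtain rfl : h = H + 1 := by omega
      simp [hVrtop, hVgtop, hVtop]
    | succ k ih =>
      intro h h1 hk
      have hh : h ∈ Finset.Icc 1 H := Finset.mem_Icc.2 ⟨h1, by omega⟩
      have ih' := ih (h + 1) (by omega) (by omega)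
      have hbound : ∀ s a, r s a + lam * g s a +
          ∑ s', P s a s' * (Vr (h + 1) s' + lam * Vg (h + 1) s') ≤
            (1 + 2 / γ) * (k + 1 : ℕ) := by
        intro s a
        have hnext := sum_weight_mul_le_of_le (hP0 s a) (hP1 s a) fun s' => (ih' s').2
        have hc := hcost s a
        push_cast
        linarith
      have hkH : (1 + 2 / γ) * ((k + 1 : ℕ) : ℝ) ≤ (1 + 2 / γ) * H :=
        mul_le_mul_of_nonneg_left (by exact_mod_cast (by omega : k + 1 ≤ H)) (by linarith)
      have hQle : ∀ s a, r s a + lam * g s a +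
          ∑ s', P s a s' * (Vr (h + 1) s' + lam * Vg (h + 1) s') ≤ Qf h s a := by
        intro s a
        rw [hQ h hh]
        refine le_min ?_ ((hbound s a).trans hkH)
        have hmono : ∑ s', P s a s' * (Vr (h + 1) s' + lam * Vg (h + 1) s') ≤
            ∑ s', P s a s' * V (h + 1) s' :=
          Finset.sum_le_sum fun s' _ => mul_le_mul_of_nonneg_left (ih' s').1 (hP0 s a s')
        have hdev := (abs_le.1 (hconc h hh s a)).1
        linarith
      have hVtle : ∀ s, Vr h s + lam * Vg h s ≤ Vt h s := by
        intro s
        rw [hrec h hh, hVt h hh]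
        exact sum_weight_mul_le_of_le (hπ0 s) (hπ1 s) fun a =>
          (hQle s a).trans (le_ciSup (Set.finite_range (Qf h s)).bddAbove a)
      intro s
      constructor
      · rw [hV h hh]
        exact le_min_ciInf_add_of_span_le hVtle (hspan h hh) s
      · rw [hrec h hh]
        exact sum_weight_mul_le_of_le (hπ0 s) (hπ1 s) (hbound s)
  intro h hh s
  obtain ⟨h1, h2⟩ := Finset.mem_Icc.1 hh
  exact (key (H + 1 - h) h h1 (by omega) s).1
end
end

section
/- Characterization of the relative interior of a standard-form polyhedron: Let X = { x ∈ ℝⁿ | x_i ≥ 0 for all i, and A x = b } be nonempty, and let I₊ = { i | there exists x ∈ X with x_i > 0 }. Suppose I₊ is nonempty. Then for every x ∈ X, x belongs to the relative interior of X if and only if x_i > 0 for every i ∈ I₊. -/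
open Matrix

/-- From a point of the intrinsic interior, one can move slightly past it, away from any other
point of the set, without leaving the set. -/
theorem exists_neg_lineMap_mem_of_mem_intrinsicInterior {E : Type*} [AddCommGroup E] [Module ℝ E]
    [TopologicalSpace E] [IsTopologicalAddGroup E] [ContinuousSMul ℝ E] {s : Set E} {x y : E}
    (hx : x ∈ intrinsicInterior ℝ s) (hy : y ∈ s) :
    ∃ t : ℝ, t < 0 ∧ AffineMap.lineMap x y t ∈ s := by
  obtain ⟨x, hx, rfl⟩ := mem_intrinsicInterior.1 hx
  let f : ℝ → affineSpan ℝ s := fun t =>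
    ⟨AffineMap.lineMap (x : E) y t,
      AffineMap.lineMap_mem t x.2 (subset_affineSpan ℝ s hy)⟩
  have hf : Continuous f := by
    refine Continuous.subtype_mk ?_ _
    change Continuous fun t : ℝ => t • (y - (x : E)) + x
    fun_prop
  have hf0 : f 0 = x := Subtype.ext (by simp [f])
  have hmem : ∀ᶠ t in nhds (0 : ℝ), f t ∈ interior ((↑) ⁻¹' s : Set (affineSpan ℝ s)) :=
    hf.continuousAt.eventually_mem (isOpen_interior.mem_nhds (by rwa [hf0]))
  obtain ⟨t, ht, ht0⟩ :=
    ((hmem.filter_mono nhdsWithin_le_nhds).and (self_mem_nhdsWithin (s := Set.Iio 0))).exists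
  have hts : f t ∈ ((↑) ⁻¹' s : Set (affineSpan ℝ s)) := interior_subset ht
  exact ⟨t, ht0, hts⟩

/-- A point of a set that has a neighborhood meeting the affine span only inside the set lies in
the intrinsic interior. -/
theorem mem_intrinsicInterior_of_isOpen {E : Type*} [AddCommGroup E] [Module ℝ E]
    [TopologicalSpace E] {s U : Set E} {x : E} (hU : IsOpen U) (hxU : x ∈ U) (hx : x ∈ s)
    (h : ∀ z ∈ affineSpan ℝ s, z ∈ U → z ∈ s) : x ∈ intrinsicInterior ℝ s :=
  mem_intrinsicInterior.2 ⟨⟨x, subset_affineSpan ℝ s hx⟩,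
    mem_interior.2 ⟨Subtype.val ⁻¹' U, fun z hz => h z z.2 hz, hU.preimage continuous_subtype_val, hxU⟩,
    rfl⟩

/-- **Characterization of the relative interior of a standard-form polyhedron.**
For `X = {x | x ≥ 0, A x = b}` nonempty with `I₊ = {i | ∃ x ∈ X, x_i > 0}` nonempty,
a point `x ∈ X` lies in the relative interior of `X` iff `x_i > 0` for every `i ∈ I₊`. -/
theorem relint_standard_form_polyhedron
    (m n : ℕ) (A : Matrix (Fin m) (Fin n) ℝ) (b : Fin m → ℝ)
    (X : Set (Fin n → ℝ))
    (hX : X = {x : Fin n → ℝ | (∀ i, 0 ≤ x i) ∧ A *ᵥ x = b})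
    (hne : X.Nonempty)
    (hIplus : ∃ i : Fin n, ∃ x ∈ X, 0 < x i) :
    ∀ x ∈ X, (x ∈ intrinsicInterior ℝ X ↔ ∀ i : Fin n, (∃ y ∈ X, 0 < y i) → 0 < x i) := by
  have hmem (z : Fin n → ℝ) : z ∈ X ↔ (∀ i, 0 ≤ z i) ∧ A *ᵥ z = b := by rw [hX]; rfl
  intro x hx
  constructor
  · rintro hxi i ⟨y, hy, hyi⟩
    obtain ⟨t, ht, htX⟩ := exists_neg_lineMap_mem_of_mem_intrinsicInterior hxi hy
    have hi := ((hmem _).1 htX).1 i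
    simp only [AffineMap.lineMap_apply_module', Pi.add_apply, Pi.smul_apply, Pi.sub_apply,
      smul_eq_mul] at hi
    have hxi0 := ((hmem x).1 hx).1 i
    by_contra hneg
    have hxi_eq : x i = 0 := le_antisymm (not_lt.1 hneg) hxi0
    rw [hxi_eq] at hi
    nlinarith
  · intro hpos
    have hopen : IsOpen {z : Fin n → ℝ | ∀ i, (∃ y ∈ X, 0 < y i) → 0 < z i} := by
      simp only [Set.ofPred_forall]
      exact isOpen_iInter_of_finite fun i => isOpen_iInter_of_finite fun _ =>
        isOpen_lt continuous_const (continuous_apply i)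
    refine mem_intrinsicInterior_of_isOpen hopen hpos hx fun z hz hzpos => ?_
    have hspan : A *ᵥ z = b ∧ ∀ i, (¬ ∃ y ∈ X, 0 < y i) → z i = 0 := by
      refine affineSpan_induction hz (fun y hy => ⟨((hmem y).1 hy).2, fun i hi => ?_⟩) ?_
      · exact le_antisymm (not_lt.1 fun h => hi ⟨y, hy, h⟩) (((hmem y).1 hy).1 i)
      · rintro c u v w ⟨hu, hu0⟩ ⟨hv, hv0⟩ ⟨hw, hw0⟩
        constructor
        · simp [Matrix.mulVec_add, Matrix.mulVec_smul, Matrix.mulVec_sub, hu, hv, hw]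
        · intro i hi
          simp [hu0 i hi, hv0 i hi, hw0 i hi]
    refine (hmem z).2 ⟨fun i => ?_, hspan.1⟩
    by_cases hi : ∃ y ∈ X, 0 < y i
    · exact (hzpos i hi).le
    · exact (hspan.2 i hi).ge
end

section
/- Linear optimization over a set sandwiched between the relative interior together with the extreme points of a polytope and the polytope itself: Let 𝓟 = conv(F) ⊆ ℝⁿ where F is a nonempty finite subset of ℝⁿ, let P̂ ⊆ 𝓟 satisfy relint(𝓟) ∪ ext(𝓟) ⊆ P̂, and let r, g ∈ ℝⁿ and b ∈ ℝ be such that { q ∈ P̂ | ⟪g, q⟫ ≥ b } is nonempty. Then sup { ⟪r, q⟫ | q ∈ P̂, ⟪g, q⟫ ≥ b } = sup { ⟪r, q⟫ | q ∈ 𝓟, ⟪g, q⟫ ≥ b }, and the latter supremum is attained: there exists q* ∈ 𝓟 with ⟪g, q*⟫ ≥ b and ⟪r, q*⟫ = sup { ⟪r, q⟫ | q ∈ 𝓟, ⟪g, q⟫ ≥ b }. -/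
open Finset

/-- The half-open segment from a point of the relative interior of a convex set towards any other
point of the set stays in the relative interior. -/
theorem Convex.lineMap_mem_intrinsicInterior {E : Type*} [NormedAddCommGroup E] [NormedSpace ℝ E]
    {s : Set E} (hs : Convex ℝ s) {y z : E} (hy : y ∈ s) (hz : z ∈ intrinsicInterior ℝ s)
    {t : ℝ} (ht : t ∈ Set.Ioc (0 : ℝ) 1) :
    AffineMap.lineMap y z t ∈ intrinsicInterior ℝ s := by
  obtain ⟨z', hz', rfl⟩ := mem_intrinsicInterior.1 hz
  obtain ⟨U, hUs, hU, hzU⟩ := mem_interior.1 hz'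
  obtain ⟨V, hV, rfl⟩ := isOpen_induced_iff.1 hU
  have hyA : y ∈ affineSpan ℝ s := subset_affineSpan ℝ s hy
  have hcont : Continuous fun w : E => AffineMap.lineMap (k := ℝ) y w t⁻¹ := by
    simp only [AffineMap.lineMap_apply_module]
    fun_prop
  refine mem_intrinsicInterior.2
    ⟨⟨_, AffineMap.lineMap_mem t hyA z'.2⟩, mem_interior.2 ⟨_, ?_,
      (hV.preimage hcont).preimage continuous_subtype_val, ?_⟩, rfl⟩
  · rintro ⟨w, hwA⟩ hw
    have hmem : AffineMap.lineMap (k := ℝ) y w t⁻¹ ∈ s :=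
      hUs (a := ⟨_, AffineMap.lineMap_mem t⁻¹ hyA hwA⟩) hw
    have := hs.lineMap_mem hy hmem ⟨ht.1.le, ht.2⟩
    rwa [AffineMap.lineMap_lineMap_right, mul_inv_cancel₀ ht.1.ne', AffineMap.lineMap_apply_one]
      at this
  · simpa [AffineMap.lineMap_lineMap_right, inv_mul_cancel₀ ht.1.ne'] using hzU

/-- An upper bound for a linear functional on the part of a half-space lying in the relative
interior or among the extreme points of a compact convex set is an upper bound on the whole part of
the half-space lying in the set, provided the half-space meets the set. -/
theorem IsCompact.le_of_forall_intrinsicInterior_union_extremePoints {E : Type*}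
    [NormedAddCommGroup E] [NormedSpace ℝ E] [FiniteDimensional ℝ E] {s : Set E}
    (hsc : IsCompact s) (hs : Convex ℝ s) (f g : E →L[ℝ] ℝ) {b m : ℝ}
    (hm : ∀ q ∈ intrinsicInterior ℝ s ∪ Set.extremePoints ℝ s, b ≤ g q → f q ≤ m)
    {q : E} (hq : q ∈ s) (hgq : b ≤ g q) : f q ≤ m := by
  have htend : ∀ (l : E →L[ℝ] ℝ) (y z : E),
      Filter.Tendsto (fun t : ℝ => l (AffineMap.lineMap y z t)) (nhdsWithin 0 (Set.Ioi 0))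
        (nhds (l y)) := fun l y z => by
    have hc : Continuous fun t : ℝ => l (AffineMap.lineMap y z t) := by
      simp only [AffineMap.lineMap_apply_module]
      fun_prop
    simpa using (hc.tendsto 0).mono_left nhdsWithin_le_nhds
  have hIoc : Set.Ioc (0 : ℝ) 1 ∈ nhdsWithin (0 : ℝ) (Set.Ioi 0) := Ioc_mem_nhdsGT one_pos
  by_cases hslater : ∃ p ∈ s, b < g p
  · obtain ⟨p, hp, hbp⟩ := hslater
    obtain ⟨z, hz⟩ := Set.Nonempty.intrinsicInterior hs ⟨q, hq⟩
    obtain ⟨t, ht, hbt⟩ :=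
      (Filter.Eventually.and hIoc ((htend g p z).eventually (lt_mem_nhds hbp))).exists
    set w : E := AffineMap.lineMap p z t
    have hw : w ∈ intrinsicInterior ℝ s := hs.lineMap_mem_intrinsicInterior hp hz ht
    refine le_of_tendsto (htend f q w) ?_
    filter_upwards [hIoc] with u hu
    refine hm _ (Or.inl (hs.lineMap_mem_intrinsicInterior hq hw hu)) ?_
    simp only [AffineMap.lineMap_apply_module, map_add, map_smul, smul_eq_mul]
    nlinarith [hu.1, hu.2]
  · push Not at hslater
    set S : Set E := g.toExposed s
    have hmemS : ∀ x, x ∈ S ↔ x ∈ s ∧ b ≤ g x := fun x =>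
      ⟨fun hx => ⟨hx.1, hgq.trans (hx.2 q hq)⟩,
        fun hx => ⟨hx.1, fun y hy => (hslater y hy).trans hx.2⟩⟩
    have hS : IsExposed ℝ s S := ContinuousLinearMap.toExposed.isExposed
    have hT : IsExposed ℝ S (f.toExposed S) := ContinuousLinearMap.toExposed.isExposed
    have hScomp : IsCompact S := hS.isCompact hsc
    have hqS : q ∈ S := (hmemS q).2 ⟨hq, hgq⟩
    obtain ⟨x, hxS, hx⟩ := hScomp.exists_isMaxOn ⟨q, hqS⟩ f.continuous.continuousOn
    obtain ⟨e, he⟩ := (hT.isCompact hScomp).extremePoints_nonempty ⟨x, hxS, fun y hy => hx hy⟩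
    have heT : e ∈ f.toExposed S := he.1
    exact (heT.2 q hqS).trans
      (hm e (Or.inr ((hS.isExtreme.trans hT.isExtreme).extremePoints_subset_extremePoints he))
        ((hmemS e).1 heT.1).2)

/-- **Linear optimization over a set sandwiched between `relint(𝓟) ∪ ext(𝓟)` and a polytope
`𝓟 = conv(F)`.** The supremum of a linear objective over the feasible part of `P̂` equals the
supremum over the feasible part of `𝓟`, and the latter is attained. -/
theorem sandwiched_linear_optimization
    (n : ℕ) (F : Finset (Fin n → ℝ)) (hF : F.Nonempty)
    (Phat : Set (Fin n → ℝ))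
    (hsub : Phat ⊆ convexHull ℝ (F : Set (Fin n → ℝ)))
    (hsup : intrinsicInterior ℝ (convexHull ℝ (F : Set (Fin n → ℝ))) ∪
        Set.extremePoints ℝ (convexHull ℝ (F : Set (Fin n → ℝ))) ⊆ Phat)
    (r g : Fin n → ℝ) (b : ℝ)
    (hfeas : {q ∈ Phat | b ≤ ∑ i, g i * q i}.Nonempty) :
    sSup {x | ∃ q ∈ Phat, b ≤ ∑ i, g i * q i ∧ x = ∑ i, r i * q i} =
        sSup {x | ∃ q ∈ convexHull ℝ (F : Set (Fin n → ℝ)),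
          b ≤ ∑ i, g i * q i ∧ x = ∑ i, r i * q i} ∧
      ∃ qstar ∈ convexHull ℝ (F : Set (Fin n → ℝ)), b ≤ ∑ i, g i * qstar i ∧
        (∑ i, r i * qstar i) =
          sSup {x | ∃ q ∈ convexHull ℝ (F : Set (Fin n → ℝ)),
            b ≤ ∑ i, g i * q i ∧ x = ∑ i, r i * q i} := by
  let L : (Fin n → ℝ) → (Fin n → ℝ) →L[ℝ] ℝ := fun v =>
    ∑ i, v i • ContinuousLinearMap.proj (R := ℝ) (φ := fun _ : Fin n => ℝ) i
  have hL : ∀ v q, L v q = ∑ i, v i * q i := fun v q => by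
    simp [L]
  simp only [← hL] at hfeas ⊢
  set s := convexHull ℝ (F : Set (Fin n → ℝ))
  have hsc : IsCompact s := F.finite_toSet.isCompact_convexHull (𝕜 := ℝ)
  have hs : Convex ℝ s := convex_convexHull ℝ _
  obtain ⟨q₀, hq₀, hbq₀⟩ := hfeas
  obtain ⟨x, ⟨hxs, hbx⟩, hx⟩ :=
    (hsc.inter_right (isClosed_le continuous_const (L g).continuous)).exists_isMaxOn
      ⟨q₀, hsub hq₀, hbq₀⟩ (L r).continuous.continuousOn
  have hmax : ∀ q ∈ s, b ≤ L g q → L r q ≤ L r x := fun q hq hbq => hx ⟨hq, hbq⟩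
  have hP : IsGreatest {y | ∃ q ∈ s, b ≤ L g q ∧ y = L r q} (L r x) :=
    ⟨⟨x, hxs, hbx, rfl⟩, by rintro _ ⟨q, hq, hbq, rfl⟩; exact hmax q hq hbq⟩
  have hPhat : IsLUB {y | ∃ q ∈ Phat, b ≤ L g q ∧ y = L r q} (L r x) := by
    refine ⟨by rintro _ ⟨q, hq, hbq, rfl⟩; exact hmax q (hsub hq) hbq, fun m hm => ?_⟩
    exact hsc.le_of_forall_intrinsicInterior_union_extremePoints hs (L r) (L g)
      (fun q hq hbq => hm ⟨q, hsup hq, hbq, rfl⟩) hxs hbx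
  rw [hP.csSup_eq, hPhat.csSup_eq ⟨_, q₀, hq₀, hbq₀, rfl⟩]
  exact ⟨rfl, x, hxs, hbx, rfl⟩
end

section
/- Unique stationary distribution of a unichain stochastic matrix: Let M be a stochastic matrix on a finite nonempty type S. Suppose C ⊆ S is nonempty, closed under M, and irreducible under M, and that every state s ∉ C is transient under M. Then M has exactly one stationary distribution d, and this d satisfies d(s) > 0 for every s ∈ C and d(s) = 0 for every s ∉ C. -/
open Finset Filter Topology

noncomputable section

/-- `M` is a stochastic matrix: nonnegative entries with unit row sums. -/
def IsStochastic {S : Type*} [Fintype S] (M : Matrix S S ℝ) : Prop :=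
  (∀ s s', 0 ≤ M s s') ∧ ∀ s, ∑ s', M s s' = 1

/-- `d` is a stationary distribution for `M`. -/
def IsStationaryDist {S : Type*} [Fintype S] (M : Matrix S S ℝ) (d : S → ℝ) : Prop :=
  (∀ s, 0 ≤ d s) ∧ (∑ s, d s = 1) ∧ ∀ s, ∑ s', M s' s * d s' = d s

open Matrix in
lemma isStationaryDist_iff_vecMul {S : Type*} [Fintype S] {M : Matrix S S ℝ} {d : S → ℝ} :
    IsStationaryDist M d ↔ (∀ s, 0 ≤ d s) ∧ (∑ s, d s = 1) ∧ d ᵥ* M = d := by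
  simp only [IsStationaryDist, funext_iff, Matrix.vecMul, dotProduct, mul_comm]

section Invariant

open Matrix

variable {S : Type*} [Fintype S] {M : Matrix S S ℝ} {v : S → ℝ}

lemma IsStochastic.sum_vecMul (hM : IsStochastic M) (v : S → ℝ) :
    ∑ s, (v ᵥ* M) s = ∑ s, v s := by
  simp only [Matrix.vecMul, dotProduct]
  rw [Finset.sum_comm]
  simp [← Finset.mul_sum, hM.2]

lemma IsStochastic.vecMul_eq_of_le (hM : IsStochastic M) (h : ∀ s, v s ≤ (v ᵥ* M) s) :
    v ᵥ* M = v := by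
  have := (Finset.sum_eq_sum_iff_of_le fun s (_ : s ∈ univ) => h s).1 (hM.sum_vecMul v).symm
  exact funext fun s => (this s (mem_univ s)).symm

lemma IsStochastic.vecMul_eq_of_ge (hM : IsStochastic M) (h : ∀ s, (v ᵥ* M) s ≤ v s) :
    v ᵥ* M = v := by
  have := (Finset.sum_eq_sum_iff_of_le fun s (_ : s ∈ univ) => h s).1 (hM.sum_vecMul v)
  exact funext fun s => this s (mem_univ s)

lemma IsStochastic.abs_vecMul_eq (hM : IsStochastic M) (hv : v ᵥ* M = v) : |v| ᵥ* M = |v| := by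
  refine hM.vecMul_eq_of_le fun s => ?_
  calc |v| s = |(v ᵥ* M) s| := by rw [hv, Pi.abs_apply]
    _ ≤ ∑ t, |v t * M t s| := Finset.abs_sum_le_sum_abs _ _
    _ = (|v| ᵥ* M) s := by
      simp [Matrix.vecMul, dotProduct, abs_mul, abs_of_nonneg (hM.1 _ _)]

lemma IsStochastic.posPart_vecMul_eq (hM : IsStochastic M) (hv : v ᵥ* M = v) :
    v⁺ ᵥ* M = v⁺ := by
  have h : v⁺ = (2⁻¹ : ℝ) • (|v| + v) := by
    ext s
    rw [Pi.posPart_apply, Pi.smul_apply, Pi.add_apply, Pi.abs_apply, smul_eq_mul, posPart_def]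
    rcases le_total 0 (v s) with hs | hs
    · rw [sup_eq_left.2 hs, abs_of_nonneg hs]; ring
    · rw [sup_eq_right.2 hs, abs_of_nonpos hs]; ring
  rw [h, Matrix.smul_vecMul, Matrix.add_vecMul, hM.abs_vecMul_eq hv, hv]

variable [DecidableEq S]

lemma vecMul_pow_eq (hv : v ᵥ* M = v) (n : ℕ) : v ᵥ* M ^ n = v := by
  induction n with
  | zero => simp
  | succ n ih => rw [pow_succ, ← Matrix.vecMul_vecMul, ih, hv]

lemma IsStochastic.pow_nonneg (hM : IsStochastic M) (n : ℕ) (s t : S) : 0 ≤ (M ^ n) s t := by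
  induction n generalizing t with
  | zero => rw [pow_zero, Matrix.one_apply]; split_ifs <;> norm_num
  | succ n ih =>
    rw [pow_succ, Matrix.mul_apply]
    exact Finset.sum_nonneg fun u _ => mul_nonneg (ih u) (hM.1 u t)

lemma IsStochastic.pow_mul_pow_le (hM : IsStochastic M) (m n : ℕ) (s t u : S) :
    (M ^ m) s t * (M ^ n) t u ≤ (M ^ (m + n)) s u := by
  rw [pow_add, Matrix.mul_apply]
  exact Finset.single_le_sum (f := fun t => (M ^ m) s t * (M ^ n) t u)
    (fun i _ => mul_nonneg (hM.pow_nonneg m s i) (hM.pow_nonneg n i u)) (mem_univ t)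

lemma IsStochastic.pos_of_pow_pos (hM : IsStochastic M) (hv : v ᵥ* M = v) (h0 : ∀ s, 0 ≤ v s)
    {s t : S} (hs : 0 < v s) {n : ℕ} (hn : 0 < (M ^ n) s t) : 0 < v t := by
  rw [← vecMul_pow_eq hv n]
  exact (mul_pos hs hn).trans_le <| Finset.single_le_sum (f := fun s => v s * (M ^ n) s t)
    (fun i _ => mul_nonneg (h0 i) (hM.pow_nonneg n i t)) (mem_univ s)

lemma IsStochastic.eq_zero_of_isTransient (hM : IsStochastic M) (hv : v ᵥ* M = v)
    (h0 : ∀ s, 0 ≤ v s) {s : S} (hs : IsTransient M s) : v s = 0 := by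
  let R : Set S := {t | ∃ n : ℕ, 0 < (M ^ n) s t}
  have hsR : s ∈ R := ⟨0, by simp⟩
  have hR : R.indicator v ᵥ* M = R.indicator v := by
    refine hM.vecMul_eq_of_ge fun t => ?_
    by_cases ht : t ∈ R
    · calc (R.indicator v ᵥ* M) t ≤ (v ᵥ* M) t :=
            Finset.sum_le_sum fun i _ => mul_le_mul_of_nonneg_right
              (Set.indicator_le_self' (fun _ _ => h0 _) i) (hM.1 i t)
        _ = R.indicator v t := by rw [hv, Set.indicator_of_mem ht]
    · rw [Set.indicator_of_notMem ht]
      refine (Finset.sum_eq_zero fun i _ => ?_).le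
      by_cases hi : i ∈ R
      · obtain ⟨n, hn⟩ := hi
        have hit : M i t = 0 := by
          refine le_antisymm (not_lt.1 fun hpos => ht ⟨n + 1, ?_⟩) (hM.1 i t)
          refine lt_of_lt_of_le ?_ (hM.pow_mul_pow_le n 1 s i t)
          rw [pow_one]
          exact mul_pos hn hpos
        exact mul_eq_zero_of_right _ hit
      · exact mul_eq_zero_of_left (Set.indicator_of_notMem hi v) _
  have hret : Tendsto (fun n => (M ^ n) s s) atTop (𝓝 0) :=
    (tendsto_add_atTop_iff_nat 1).1 hs.tendsto_atTop_zero
  have hzero (t : S) (ht : t ∈ R) : Tendsto (fun n => (M ^ n) t s) atTop (𝓝 0) := by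
    obtain ⟨m, hm⟩ := ht
    have hlim : Tendsto (fun n => (M ^ (m + n)) s s / (M ^ m) s t) atTop (𝓝 0) := by
      simpa [add_comm] using ((tendsto_add_atTop_iff_nat m).2 hret).div_const ((M ^ m) s t)
    refine squeeze_zero (fun n => hM.pow_nonneg n t s) (fun n => ?_) hlim
    rw [le_div_iff₀ hm, mul_comm]
    exact hM.pow_mul_pow_le m n s t s
  have hsum : Tendsto (fun n => (R.indicator v ᵥ* M ^ n) s) atTop (𝓝 (∑ _t : S, 0)) := by
    refine tendsto_finsetSum _ fun t _ => ?_
    by_cases ht : t ∈ R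
    · simpa using (hzero t ht).const_mul (R.indicator v t)
    · simp [Set.indicator_of_notMem ht]
  simp only [vecMul_pow_eq hR, Set.indicator_of_mem hsR, Finset.sum_const_zero] at hsum
  exact tendsto_nhds_unique tendsto_const_nhds hsum

lemma IsStochastic.exists_isStationaryDist [Nonempty S] (hM : IsStochastic M) :
    ∃ d, IsStationaryDist M d := by
  have hdet : (M - 1).det = 0 := by
    refine Matrix.exists_mulVec_eq_zero_iff.1 ⟨1, one_ne_zero, ?_⟩
    rw [Matrix.sub_mulVec, Matrix.one_mulVec, sub_eq_zero]
    ext s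
    simp [Matrix.mulVec, dotProduct, hM.2]
  obtain ⟨v, hv0, hv⟩ := Matrix.exists_vecMul_eq_zero_iff.2 hdet
  rw [Matrix.vecMul_sub, Matrix.vecMul_one, sub_eq_zero] at hv
  obtain ⟨s, hs⟩ := Function.ne_iff.1 hv0
  have hpos : 0 < ∑ s, |v| s :=
    Finset.sum_pos' (fun t _ => abs_nonneg (v t)) ⟨s, mem_univ s, abs_pos.2 hs⟩
  refine ⟨(∑ s, |v| s)⁻¹ • |v|, isStationaryDist_iff_vecMul.2 ⟨fun t => ?_, ?_, ?_⟩⟩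
  · exact mul_nonneg (inv_nonneg.2 hpos.le) (abs_nonneg (v t))
  · simp only [Pi.smul_apply, smul_eq_mul, ← Finset.mul_sum]
    exact inv_mul_cancel₀ hpos.ne'
  · rw [Matrix.smul_vecMul, hM.abs_vecMul_eq hv]

lemma IsStochastic.pos_of_isIrreducibleOn (hM : IsStochastic M) {C : Set S}
    (hirr : IsIrreducibleOn M C) (htrans : ∀ s ∉ C, IsTransient M s) (hv : v ᵥ* M = v)
    (h0 : ∀ s, 0 ≤ v s) {s : S} (hs : 0 < v s) : ∀ t ∈ C, 0 < v t := by
  have hsC : s ∈ C := by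
    by_contra h
    exact hs.ne' (hM.eq_zero_of_isTransient hv h0 (htrans s h))
  intro t ht
  obtain ⟨n, hn⟩ := hirr s hsC t ht
  exact hM.pos_of_pow_pos hv h0 hs hn

lemma IsStochastic.eq_zero_of_sum_eq_zero (hM : IsStochastic M) {C : Set S}
    (hirr : IsIrreducibleOn M C) (htrans : ∀ s ∉ C, IsTransient M s) (hv : v ᵥ* M = v)
    (hsum : ∑ s, v s = 0) (hoff : ∀ s ∉ C, v s = 0) : v = 0 := by
  by_cases h : ∃ s, 0 < v s
  · obtain ⟨s, hs⟩ := h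
    have hpos := hM.pos_of_isIrreducibleOn hirr htrans (hM.posPart_vecMul_eq hv)
      (fun t => posPart_nonneg v t) (s := s) (by simpa [Pi.posPart_apply] using hs)
    have hnonneg (t : S) : 0 ≤ v t := by
      by_cases ht : t ∈ C
      · have := hpos t ht
        rw [Pi.posPart_apply, posPart_pos_iff] at this
        exact this.le
      · exact (hoff t ht).ge
    exact funext fun t => (Finset.sum_eq_zero_iff_of_nonneg fun t _ => hnonneg t).1 hsum t
      (mem_univ t)
  · push Not at h
    exact funext fun t => (Finset.sum_eq_zero_iff_of_nonpos fun t _ => h t).1 hsum t (mem_univ t)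

end Invariant

/-- **Unique stationary distribution of a unichain stochastic matrix.** If `C` is a nonempty
closed irreducible class of `M` and all states outside `C` are transient, then `M` has exactly
one stationary distribution, and it is positive on `C` and vanishes off `C`. -/
theorem unichain_unique_stationary_distribution
    {S : Type*} [Fintype S] [DecidableEq S] [Nonempty S]
    (M : Matrix S S ℝ) (hM : IsStochastic M)
    (C : Set S) (hC : C.Nonempty)
    (hclosed : IsClosedClass M C) (hirr : IsIrreducibleOn M C)
    (htrans : ∀ s ∉ C, IsTransient M s) :
    (∃! d : S → ℝ, IsStationaryDist M d) ∧
      ∀ d : S → ℝ, IsStationaryDist M d →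
        (∀ s ∈ C, 0 < d s) ∧ ∀ s ∉ C, d s = 0 := by
  have hoff (d : S → ℝ) (hd : IsStationaryDist M d) (s : S) (hs : s ∉ C) : d s = 0 :=
    hM.eq_zero_of_isTransient (isStationaryDist_iff_vecMul.1 hd).2.2 hd.1 (htrans s hs)
  refine ⟨?_, fun d hd => ⟨?_, hoff d hd⟩⟩
  · obtain ⟨d, hd⟩ := hM.exists_isStationaryDist
    refine ⟨d, hd, fun e he => sub_eq_zero.1 <|
      hM.eq_zero_of_sum_eq_zero hirr htrans ?_ ?_ fun s hs => ?_⟩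
    · rw [Matrix.sub_vecMul, (isStationaryDist_iff_vecMul.1 he).2.2,
        (isStationaryDist_iff_vecMul.1 hd).2.2]
    · simp [Finset.sum_sub_distrib, he.2.1, hd.2.1]
    · simp [hoff d hd s hs, hoff e he s hs]
  · obtain ⟨s, -, hs⟩ := Finset.exists_lt_of_sum_lt (s := univ) (f := fun _ => (0 : ℝ)) (g := d)
      (by simp [hd.2.1])
    exact hM.pos_of_isIrreducibleOn hirr htrans (isStationaryDist_iff_vecMul.1 hd).2.2 hd.1 hs
end
end

section
/- Bound on the number of determinant-doubling episodes: Let d, K, H be positive integers and T = K·H, let φ : {1,…,K} × {1,…,H} → ℝ^d satisfy ‖φ(k,h)‖ ≤ 1 for all k, h, and define Σ_k = I + ∑_{τ=1}^{k-1} ∑_{h=1}^{H} φ(τ,h) φ(τ,h)ᵀ for k = 1, …, K+1. Then the number of indices k ∈ {1,…,K} with 2·det(Σ_k) < det(Σ_{k+1}) is at most (3/2)·d·log(1 + T). -/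
open Finset Matrix

noncomputable section

theorem posDef_add_sum_vecMulVec_self {n ι : Type*} [Fintype n] {A : Matrix n n ℝ}
    (hA : A.PosDef) (s : Finset ι) (v : ι → n → ℝ) :
    (A + ∑ i ∈ s, vecMulVec (v i) (v i)).PosDef :=
  hA.add_posSemidef <| posSemidef_sum s fun i _ => by
    simpa using posSemidef_vecMulVec_self_star (v i)

theorem det_le_det_add_vecMulVec_self {n : Type*} [Fintype n] [DecidableEq n]
    {A : Matrix n n ℝ} (hA : A.PosDef) (v : n → ℝ) :
    A.det ≤ (A + vecMulVec v v).det := by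
  have hinv : 0 ≤ v ⬝ᵥ (A⁻¹ *ᵥ v) := by
    simpa using hA.inv.posSemidef.dotProduct_mulVec_nonneg v
  have hdet : (A + vecMulVec v v).det = A.det * (1 + v ⬝ᵥ (A⁻¹ *ᵥ v)) := by
    rw [vecMulVec_eq Unit, det_add_replicateCol_mul_replicateRow hA.det_pos.ne'.isUnit,
      Matrix.mul_assoc, ← replicateCol_mulVec, det_unique (n := Unit)]
    simp [Matrix.mul_apply, dotProduct]
  rw [hdet]
  nlinarith [mul_nonneg hA.det_pos.le hinv]

theorem det_le_det_add_sum_vecMulVec_self {n ι : Type*} [Fintype n] [DecidableEq n]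
    {A : Matrix n n ℝ} (hA : A.PosDef) (s : Finset ι) (v : ι → n → ℝ) :
    A.det ≤ (A + ∑ i ∈ s, vecMulVec (v i) (v i)).det := by
  classical
  induction s using Finset.induction_on with
  | empty => simp
  | insert i s hi ih =>
    rw [sum_insert hi, add_comm (vecMulVec _ _), ← add_assoc]
    exact ih.trans (det_le_det_add_vecMulVec_self (posDef_add_sum_vecMulVec_self hA s v) (v i))

theorem log_det_le_of_trace_le {n : Type*} [Fintype n] [DecidableEq n]
    {A : Matrix n n ℝ} (hA : A.PosDef) {c : ℝ} (hc : 0 < c)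
    (htr : A.trace ≤ Fintype.card n * c) :
    Real.log A.det ≤ Fintype.card n * Real.log c := by
  have hev (i : n) : Real.log (hA.isHermitian.eigenvalues i) ≤
      Real.log c + (hA.isHermitian.eigenvalues i / c - 1) := by
    have h := Real.log_le_sub_one_of_pos (div_pos (hA.eigenvalues_pos i) hc)
    rw [Real.log_div (hA.eigenvalues_pos i).ne' hc.ne'] at h
    linarith
  have htrace : ∑ i, hA.isHermitian.eigenvalues i = A.trace := by
    simpa using hA.isHermitian.trace_eq_sum_eigenvalues.symm
  have hdiv : A.trace / c ≤ Fintype.card n := (div_le_iff₀ hc).2 htr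
  calc Real.log A.det = ∑ i, Real.log (hA.isHermitian.eigenvalues i) := by
        rw [hA.isHermitian.det_eq_prod_eigenvalues]
        exact Real.log_prod fun i _ => (hA.eigenvalues_pos i).ne'
    _ ≤ ∑ i, (Real.log c + (hA.isHermitian.eigenvalues i / c - 1)) :=
        sum_le_sum fun i _ => hev i
    _ = Fintype.card n * Real.log c + (A.trace / c - Fintype.card n) := by
        simp [sum_add_distrib, ← sum_div, htrace]
    _ ≤ Fintype.card n * Real.log c := by linarith

theorem two_pow_card_doubling_le {u : ℕ → ℝ} (h0 : 1 ≤ u 0) (hu : Monotone u) (n : ℕ) :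
    (2 : ℝ) ^ #{k ∈ range n | 2 * u k < u (k + 1)} ≤ u n := by
  induction n with
  | zero => simpa using h0
  | succ n ih =>
    rw [range_add_one, filter_insert]
    split_ifs with h
    · rw [card_insert_of_notMem (by simp), pow_succ]
      linarith
    · exact ih.trans (hu n.le_succ)

/-- **Bound on the number of determinant-doubling episodes.** For Gram matrices
`Σ_k = I + ∑_{τ<k} ∑_{h<H} φ(τ,h) φ(τ,h)ᵀ` built from unit-norm-bounded features,
the number of episodes `k < K` with `2 det(Σ_k) < det(Σ_{k+1})` is at most
`(3/2) d log(1 + T)` where `T = K·H`. -/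
theorem doubling_episode_count
    (d K H : ℕ) (hd : 0 < d) (hK : 0 < K) (hH : 0 < H)
    (φ : ℕ → ℕ → (Fin d → ℝ))
    (hφ : ∀ k < K, ∀ h < H, ∑ i, (φ k h i) ^ 2 ≤ 1)
    (Sig : ℕ → Matrix (Fin d) (Fin d) ℝ)
    (hSig : ∀ k, Sig k = 1 + ∑ τ ∈ Finset.range k, ∑ h ∈ Finset.range H,
      vecMulVec (φ τ h) (φ τ h)) :
    ({k : ℕ | k < K ∧ 2 * (Sig k).det < (Sig (k + 1)).det}.ncard : ℝ)
      ≤ (3 / 2) * (d : ℝ) * Real.log (1 + (K * H : ℕ)) := by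
  have hpos (k : ℕ) : (Sig k).PosDef := by
    rw [hSig, ← sum_product']
    exact posDef_add_sum_vecMulVec_self PosDef.one _ fun p : ℕ × ℕ => φ p.1 p.2
  have hmono : Monotone fun k => (Sig k).det := monotone_nat_of_le_succ fun k => by
    have hsucc : Sig (k + 1) = Sig k + ∑ h ∈ range H, vecMulVec (φ k h) (φ k h) := by
      rw [hSig, hSig, sum_range_succ, add_assoc]
    rw [hsucc]
    exact det_le_det_add_sum_vecMulVec_self (hpos k) _ _
  have hset : {k : ℕ | k < K ∧ 2 * (Sig k).det < (Sig (k + 1)).det} =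
      ({k ∈ range K | 2 * (Sig k).det < (Sig (k + 1)).det} : Finset ℕ) := by
    ext k
    simp
  have hpow := two_pow_card_doubling_le (u := fun k => (Sig k).det) (by simp [hSig]) hmono K
  rw [hset, Set.ncard_coe_finset]
  have hlog := Real.log_le_log (by positivity) hpow
  rw [Real.log_pow] at hlog
  have hsum : ∑ k ∈ range K, ∑ h ∈ range H, (vecMulVec (φ k h) (φ k h)).trace ≤ K * H := by
    calc _ ≤ ∑ _k ∈ range K, ∑ _h ∈ range H, (1 : ℝ) :=
          sum_le_sum fun k hk => sum_le_sum fun h hh => by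
            simpa [trace_vecMulVec, dotProduct, sq] using
              hφ k (mem_range.1 hk) h (mem_range.1 hh)
      _ = K * H := by simp
  have htr : (Sig K).trace ≤ Fintype.card (Fin d) * (1 + (K * H : ℕ) : ℝ) := by
    have hd' : (1 : ℝ) ≤ d := by exact_mod_cast hd
    have hT : (0 : ℝ) ≤ K * H := by positivity
    rw [hSig, trace_add, trace_sum]
    simp only [trace_sum, trace_one, Fintype.card_fin]
    push_cast
    nlinarith
  have hdet := log_det_le_of_trace_le (hpos K) (by positivity) htr
  rw [Fintype.card_fin] at hdet
  have hcard : (0 : ℝ) ≤ #{k ∈ range K | 2 * (Sig k).det < (Sig (k + 1)).det} := by positivity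
  nlinarith [Real.log_two_gt_d9]
end
end
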